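/- arXiv:2202.13573 — 5 statements merged into one kernel-verified Lean document; each statement's English description precedes it below -/
import Mathlib

section
/- Every nonnegative integer is represented by the ternary quadratic form x² + 2y² + 4z² over the integers except exactly the integers of the form 2^(2s+1)·(8t+7) for nonnegative integers s and t. -/
theorem exists_two_mul_abs_add_mul_le {a : ℤ} (ha : 0 < a) (t : ℤ) :
    ∃ k : ℤ, 2 * |t + k * a| ≤ a := by
  refine ⟨-((2 * t + a) / (2 * a)), ?_⟩
  have h₁ := Int.mul_ediv_add_emod (2 * t + a) (2 * a)
  have h₂ := Int.emod_nonneg (2 * t + a) (b := 2 * a) (by omega)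
  have h₃ := Int.emod_lt_of_pos (2 * t + a) (b := 2 * a) (by omega)
  generalize (2 * t + a) / (2 * a) = q at *
  rcases abs_cases (t + -q * a) with ⟨h, -⟩ | ⟨h, -⟩ <;> rw [h] <;> linarith

theorem four_mul_sq_le_sq_of_two_mul_abs_le {t a : ℤ} (h : 2 * |t| ≤ a) : 4 * t ^ 2 ≤ a ^ 2 := by
  nlinarith [sq_abs t, abs_nonneg t]

theorem eq_one_of_reduced {a D E F : ℤ} (ha : 0 < a) (hD : 0 < D) (hdisc : D * F = E ^ 2 + a)
    (haD : 3 * a ^ 2 ≤ 4 * D) (hE : 2 * |E| ≤ D) (hDF : D ≤ F) :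
    a = 1 ∧ D = 1 ∧ E = 0 ∧ F = 1 := by
  have hE2 := four_mul_sq_le_sq_of_two_mul_abs_le hE
  have hDa : 3 * D ^ 2 ≤ 4 * a := by nlinarith
  obtain rfl : a = 1 := by
    by_contra hne
    have ha2 : 2 ≤ a := by omega
    have h₁ : 3 * a ≤ 2 * D := by nlinarith
    nlinarith
  obtain rfl : D = 1 := by nlinarith
  obtain rfl : E = 0 := Int.abs_lt_one_iff.mp (by omega)
  exact ⟨rfl, rfl, rfl, by linarith⟩

/-- A positive definite integral ternary quadratic form of determinant one takes only values that
are sums of three squares. The form has Gram matrix `!![a, t, s; t, b, r; s, r, c]`. -/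
theorem sum_three_squares_of_unimodular (a b c r s t : ℤ) (ha : 0 < a) (hD : 0 < a * b - t ^ 2)
    (hdet : a * b * c + 2 * r * s * t - a * r ^ 2 - b * s ^ 2 - c * t ^ 2 = 1) (x y z : ℤ) :
    ∃ u v w : ℤ, u ^ 2 + v ^ 2 + w ^ 2 =
      a * x ^ 2 + b * y ^ 2 + c * z ^ 2 + 2 * r * y * z + 2 * s * x * z + 2 * t * x * y := by
  obtain ⟨k, hk⟩ := exists_two_mul_abs_add_mul_le ha t
  obtain ⟨l, hl⟩ := exists_two_mul_abs_add_mul_le hD (a * r - t * s)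
  obtain ⟨t₁, ht₁⟩ : ∃ t₁, t₁ = t + k * a := ⟨_, rfl⟩
  obtain ⟨b₁, hb₁⟩ : ∃ b₁, b₁ = b + 2 * k * t + k ^ 2 * a := ⟨_, rfl⟩
  obtain ⟨s₁, hs₁⟩ : ∃ s₁, s₁ = s + l * t₁ := ⟨_, rfl⟩
  obtain ⟨r₁, hr₁⟩ : ∃ r₁, r₁ = (r + k * s) + l * b₁ := ⟨_, rfl⟩
  obtain ⟨c₁, hc₁⟩ : ∃ c₁, c₁ = c + 2 * l * (r + k * s) + l ^ 2 * b₁ := ⟨_, rfl⟩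
  have hD₁ : a * b - t ^ 2 = a * b₁ - t₁ ^ 2 := by rw [hb₁, ht₁]; ring
  have hE₁ : (a * r - t * s) + l * (a * b - t ^ 2) = a * r₁ - t₁ * s₁ := by
    rw [hr₁, hs₁, hb₁, ht₁]; ring
  have hdet₁ : a * b₁ * c₁ + 2 * r₁ * s₁ * t₁ - a * r₁ ^ 2 - b₁ * s₁ ^ 2 - c₁ * t₁ ^ 2 = 1 := by
    rw [← hdet, hc₁, hr₁, hs₁, hb₁, ht₁]; ring
  have hval : a * x ^ 2 + b * y ^ 2 + c * z ^ 2 + 2 * r * y * z + 2 * s * x * z + 2 * t * x * y =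
      a * (x - k * y) ^ 2 + b₁ * (y - l * z) ^ 2 + c₁ * z ^ 2 + 2 * r₁ * (y - l * z) * z +
        2 * s₁ * (x - k * y) * z + 2 * t₁ * (x - k * y) * (y - l * z) := by
    rw [hc₁, hr₁, hs₁, hb₁, ht₁]; ring
  rw [hval]
  generalize x - k * y = X
  generalize y - l * z = Y
  rw [← ht₁] at hk
  rw [hE₁, hD₁] at hl
  have hD' := hD
  rw [hD₁] at hD'
  have hdisc : (a * b₁ - t₁ ^ 2) * (a * c₁ - s₁ ^ 2) = (a * r₁ - t₁ * s₁) ^ 2 + a := by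
    linear_combination a * hdet₁
  have hF : 0 < a * c₁ - s₁ ^ 2 := by
    refine pos_of_mul_pos_right (a := a * b₁ - t₁ ^ 2) ?_ hD'.le
    rw [hdisc]; positivity
  have hb : 0 < b₁ := by
    refine pos_of_mul_pos_right (a := a) ?_ ha.le
    linarith [sq_nonneg t₁]
  by_cases hba : b₁ < a
  · obtain ⟨u, v, w, h⟩ := sum_three_squares_of_unimodular b₁ a c₁ s₁ r₁ t₁ hb (by linarith)
      (by linarith) Y X z
    exact ⟨u, v, w, by rw [h]; ring⟩
  by_cases hFD : a * c₁ - s₁ ^ 2 < a * b₁ - t₁ ^ 2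
  · obtain ⟨u, v, w, h⟩ := sum_three_squares_of_unimodular a c₁ b₁ r₁ t₁ s₁ ha hF
      (by linarith) X z Y
    exact ⟨u, v, w, by rw [h]; ring⟩
  have haD : 3 * a ^ 2 ≤ 4 * (a * b₁ - t₁ ^ 2) := by
    linarith [four_mul_sq_le_sq_of_two_mul_abs_le hk, mul_le_mul_of_nonneg_left (not_lt.mp hba) ha.le]
  obtain ⟨rfl, h₁, h₂, h₃⟩ := eq_one_of_reduced ha hD' hdisc haD hl (not_lt.mp hFD)
  exact ⟨X + t₁ * Y + s₁ * z, Y, z,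
    by linear_combination -Y ^ 2 * h₁ - 2 * Y * z * h₂ - z ^ 2 * h₃⟩
termination_by (a.toNat, (a * b - t ^ 2).toNat)
decreasing_by
  · exact Prod.Lex.left _ _ (by omega)
  · exact Prod.Lex.right _ (by omega)

/-- Dirichlet's criterion: if `-d` is a quadratic residue modulo `d * m - 1`, then `m` is a sum of
three squares. -/
theorem sum_three_squares_of_dvd_sq_add {m d c : ℤ} (hd : 0 < d) (hm : 0 < d * m - 1)
    (h : d * m - 1 ∣ c ^ 2 + d) : ∃ x y z : ℤ, x ^ 2 + y ^ 2 + z ^ 2 = m := by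
  obtain ⟨a, ha⟩ := h
  obtain ⟨x, y, z, h⟩ := sum_three_squares_of_unimodular a (d * m - 1) m 0 1 c
    (pos_of_mul_pos_right (by rw [← ha]; positivity) hm.le) (by linarith)
    (by linear_combination -m * ha) 0 0 1
  exact ⟨x, y, z, by rw [h]; ring⟩

open scoped NumberTheorySymbols

theorem exists_dvd_sq_add_of_jacobiSym_neg {p : ℕ} (hp : p.Prime) {d : ℤ} (h : J(-d | p) = 1) :
    ∃ c : ℤ, (p : ℤ) ∣ c ^ 2 + d := by
  have : Fact p.Prime := ⟨hp⟩
  obtain ⟨c, hc⟩ := ZMod.isSquare_of_jacobiSym_eq_one h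
  refine ⟨c.val, (ZMod.intCast_zmod_eq_zero_iff_dvd _ p).mp ?_⟩
  push_cast at hc ⊢
  rw [ZMod.natCast_zmod_val]
  linear_combination -hc

theorem exists_two_mul_dvd_sq_add {p d : ℤ} (hp : Odd p) (hd : Odd d) {c : ℤ} (h : p ∣ c ^ 2 + d) :
    ∃ c' : ℤ, 2 * p ∣ c' ^ 2 + d := by
  have hcop : IsCoprime (2 : ℤ) p := by
    obtain ⟨k, rfl⟩ := hp
    exact ⟨-k, 1, by ring⟩
  rcases Int.even_or_odd c with hc | hc
  · refine ⟨c + p, hcop.mul_dvd ((((hc.add_odd hp).pow).add_odd hd).two_dvd) ?_⟩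
    have : (c + p) ^ 2 + d = (c ^ 2 + d) + p * (2 * c + p) := by ring
    rw [this]
    exact dvd_add h (dvd_mul_right _ _)
  · exact ⟨c, hcop.mul_dvd ((hc.pow.add_odd hd).two_dvd) h⟩

theorem sum_three_squares_of_mod_four_eq_two {m : ℕ} (hm : m % 4 = 2) :
    ∃ x y z : ℤ, x ^ 2 + y ^ 2 + z ^ 2 = (m : ℤ) := by
  have hcop : IsCoprime ((m : ℤ) - 1) ((4 * m : ℕ) : ℤ) := by
    obtain ⟨j, rfl⟩ : ∃ j, m = 4 * j + 2 := ⟨m / 4, by omega⟩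
    push_cast
    refine IsCoprime.mul_right ⟨1, -j, by ring⟩ ⟨-1, 1, by ring⟩
  obtain ⟨p, hpm, hp, hmod⟩ := Nat.forall_exists_prime_gt_and_zmodEq m (by omega) hcop
  obtain ⟨v, hv⟩ := hmod.symm.dvd
  push_cast at hv
  have hv0 : 0 ≤ v := by
    by_contra! h
    nlinarith
  lift v to ℕ using hv0
  have hpd : (p : ℤ) = (4 * v + 1 : ℕ) * m - 1 := by push_cast; linarith
  have hp4 : p % 4 = 1 := by
    have : (p : ℤ) = 4 * (m * v) + m - 1 := by linarith
    generalize (m : ℤ) * v = w at this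
    omega
  have hJ : J(-((4 * v + 1 : ℕ) : ℤ) | p) = 1 := by
    have hodd : Odd (4 * v + 1) := ⟨2 * v, by ring⟩
    rw [jacobiSym.neg _ (Nat.odd_iff.mpr (by omega)), ZMod.χ₄_nat_one_mod_four hp4, one_mul,
      jacobiSym.quadratic_reciprocity_one_mod_four (by omega) (Nat.odd_iff.mpr (by omega)), hpd,
      jacobiSym.mod_left' (a₂ := -1) (by rw [sub_eq_neg_add, Int.add_mul_emod_self_left]),
      jacobiSym.at_neg_one hodd, ZMod.χ₄_nat_one_mod_four (by omega)]
  obtain ⟨c, hc⟩ := exists_dvd_sq_add_of_jacobiSym_neg hp hJ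
  rw [hpd] at hc
  exact sum_three_squares_of_dvd_sq_add (by positivity) (by rw [← hpd]; exact_mod_cast hp.pos) hc

/-- The odd case of the three squares theorem, where the prime `p` of Dirichlet's criterion satisfies
`2 * p = (8 * v + k) * m - 1`. -/
theorem sum_three_squares_of_odd {m k : ℕ} (hk : k = 1 ∧ m % 8 = 3 ∨ k = 3 ∧ m % 4 = 1) :
    ∃ x y z : ℤ, x ^ 2 + y ^ 2 + z ^ 2 = (m : ℤ) := by
  obtain ⟨j, hj⟩ : ∃ j, k * m = 2 * j + 1 ∧ (j % 4 = 1 ∨ j % 2 = 1 ∧ k = 3) := by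
    refine ⟨k * m / 2, ?_⟩
    rcases hk with ⟨rfl, h⟩ | ⟨rfl, h⟩ <;> omega
  have hcop : IsCoprime (j : ℤ) ((4 * m : ℕ) : ℤ) := by
    have hj' : (k : ℤ) * m = 2 * j + 1 := by exact_mod_cast hj.1
    push_cast
    refine IsCoprime.mul_right ?_ ⟨-2, k, by linarith⟩
    obtain ⟨i, rfl⟩ : ∃ i, j = 2 * i + 1 := ⟨j / 2, by omega⟩
    have : IsCoprime ((2 * i + 1 : ℕ) : ℤ) 2 := ⟨1, -i, by push_cast; ring⟩
    simpa using this.mul_right this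
  obtain ⟨p, hpm, hp, hmod⟩ := Nat.forall_exists_prime_gt_and_zmodEq (j + 4 * m) (by omega) hcop
  obtain ⟨v, hv⟩ := hmod.symm.dvd
  push_cast at hv
  have hv0 : 0 ≤ v := by
    by_contra! h
    nlinarith
  lift v to ℕ using hv0
  have hpd : 2 * (p : ℤ) = (8 * v + k : ℕ) * m - 1 := by
    have hj' : (k : ℤ) * m = 2 * j + 1 := by exact_mod_cast hj.1
    push_cast; linarith
  have hp4 : p % 4 = j % 4 := by
    have : (p : ℤ) = 4 * (m * v) + j := by linarith
    generalize (m : ℤ) * v = w at this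
    omega
  have hodd : Odd (8 * v + k) := Nat.odd_iff.mpr (by omega)
  have hpodd : Odd p := Nat.odd_iff.mpr (by omega)
  have hp2 : J(p | 8 * v + k) = 1 := by
    have hsq : J(4 | 8 * v + k) = 1 := jacobiSym.at_four hodd
    have h := jacobiSym.mul_left (-2) (-2 * p) (8 * v + k)
    rw [show (-2 : ℤ) * (-2 * p) = 4 * p by ring, jacobiSym.mul_left, hsq, one_mul,
      jacobiSym.mod_left' (a₁ := -2 * p) (a₂ := 1), jacobiSym.one_left, mul_one,
      jacobiSym.at_neg_two hodd, ZMod.χ₈'_nat_eq_if_mod_eight, if_neg (by omega),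
      if_pos (by omega)] at h
    · exact h
    · rw [show (-2 * p : ℤ) = 1 + (8 * v + k : ℕ) * (-m) by linarith, Int.add_mul_emod_self_left]
  have hJ : J(-((8 * v + k : ℕ) : ℤ) | p) = 1 := by
    rw [jacobiSym.neg _ hpodd]
    rcases (by omega : p % 4 = 1 ∨ p % 4 = 3 ∧ (8 * v + k) % 4 = 3) with h | ⟨h, h'⟩
    · rw [ZMod.χ₄_nat_one_mod_four h, one_mul,
        jacobiSym.quadratic_reciprocity_one_mod_four' hodd h, hp2]
    · rw [ZMod.χ₄_nat_three_mod_four h, jacobiSym.quadratic_reciprocity_three_mod_four h' h, hp2]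
      norm_num
  obtain ⟨c, hc⟩ := exists_dvd_sq_add_of_jacobiSym_neg hp hJ
  obtain ⟨c, hc⟩ := exists_two_mul_dvd_sq_add (by exact_mod_cast hpodd) (by exact_mod_cast hodd) hc
  rw [hpd] at hc
  refine sum_three_squares_of_dvd_sq_add (by exact_mod_cast hodd.pos) ?_ hc
  rw [← hpd]
  exact_mod_cast Nat.mul_pos two_pos hp.pos

theorem even_of_four_dvd_sum_three_squares {x y z : ℤ} (h : 4 ∣ x ^ 2 + y ^ 2 + z ^ 2) :
    2 ∣ x ∧ 2 ∣ y ∧ 2 ∣ z := by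
  have key : ∀ w : ℤ, 2 ∣ w ∧ w ^ 2 % 4 = 0 ∨ w ^ 2 % 4 = 1 := by
    intro w
    rcases Int.even_or_odd w with hw | hw
    · obtain ⟨k, rfl⟩ := hw.two_dvd
      exact .inl ⟨dvd_mul_right _ _, by ring_nf; omega⟩
    · exact .inr (Int.sq_mod_four_eq_one_of_odd hw)
  have hx := key x
  have hy := key y
  have hz := key z
  omega

/-- **Legendre's three squares theorem**. -/
theorem sum_three_squares_iff (m : ℕ) :
    (∃ x y z : ℤ, x ^ 2 + y ^ 2 + z ^ 2 = (m : ℤ)) ↔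
      ¬ ∃ s t : ℕ, m = 4 ^ s * (8 * t + 7) := by
  constructor
  · rintro ⟨x, y, z, h⟩ ⟨s, t, rfl⟩
    induction s generalizing x y z with
    | zero =>
      have h8 := congrArg (Int.cast : ℤ → ZMod 8) h
      push_cast at h8
      rw [show (8 : ZMod 8) = 0 from rfl, zero_mul, zero_add, one_mul] at h8
      generalize (x : ZMod 8) = x, (y : ZMod 8) = y, (z : ZMod 8) = z at h8
      revert x y z
      decide
    | succ s ih =>
      push_cast at h ih
      obtain ⟨⟨x, rfl⟩, ⟨y, rfl⟩, ⟨z, rfl⟩⟩ := even_of_four_dvd_sum_three_squares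
        (x := x) (y := y) (z := z) (h ▸ ⟨4 ^ s * (8 * t + 7), by ring⟩)
      refine ih x y z ?_
      rw [pow_succ (4 : ℤ)] at h
      linarith
  · induction m using Nat.strong_induction_on with
    | h m ih =>
      intro hm
      have h7 : m % 8 ≠ 7 := fun h => hm ⟨0, m / 8, by omega⟩
      rcases Nat.eq_zero_or_pos m with rfl | hpos
      · exact ⟨0, 0, 0, by simp⟩
      rcases (by omega : m % 4 = 0 ∨ m % 4 = 2 ∨ m % 8 = 3 ∨ m % 4 = 1) with h | h | h | h
      · obtain ⟨k, rfl⟩ := Nat.dvd_of_mod_eq_zero h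
        obtain ⟨x, y, z, hxyz⟩ := ih k (by omega) fun ⟨s, t, hst⟩ =>
          hm ⟨s + 1, t, by rw [hst]; ring⟩
        exact ⟨2 * x, 2 * y, 2 * z, by push_cast; linarith⟩
      · exact sum_three_squares_of_mod_four_eq_two h
      · exact sum_three_squares_of_odd (.inl ⟨rfl, h⟩)
      · exact sum_three_squares_of_odd (.inr ⟨rfl, h⟩)

theorem exists_of_dvd_sub {n u v w : ℤ} (h : u ^ 2 + v ^ 2 + w ^ 2 = 2 * n)
    (hw : 2 ∣ w) (huv : 4 ∣ u - v) : ∃ x y z : ℤ, x ^ 2 + 2 * y ^ 2 + 4 * z ^ 2 = n := by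
  obtain ⟨y, rfl⟩ := hw
  obtain ⟨z, hz⟩ := huv
  obtain rfl : u = v + 4 * z := by linarith
  exact ⟨v + 2 * z, y, z, by linarith⟩

theorem exists_of_two_dvd_add {n u v w : ℤ} (h : u ^ 2 + v ^ 2 + w ^ 2 = 2 * n)
    (hw : 2 ∣ w) (hu : ¬ 2 ∣ u) (hv : ¬ 2 ∣ v) :
    ∃ x y z : ℤ, x ^ 2 + 2 * y ^ 2 + 4 * z ^ 2 = n := by
  rcases (by omega : 4 ∣ u - v ∨ 4 ∣ u - -v) with huv | huv
  · exact exists_of_dvd_sub h hw huv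
  · exact exists_of_dvd_sub (by rwa [neg_sq]) hw huv

/-- The form `x² + 2y² + 4z²` represents `n` if and only if `2n` is a sum of three squares. -/
theorem exists_sq_add_two_mul_sq_add_four_mul_sq_iff (n : ℤ) :
    (∃ x y z : ℤ, x ^ 2 + 2 * y ^ 2 + 4 * z ^ 2 = n) ↔
      ∃ u v w : ℤ, u ^ 2 + v ^ 2 + w ^ 2 = 2 * n := by
  constructor
  · rintro ⟨x, y, z, rfl⟩
    exact ⟨x + 2 * z, x - 2 * z, 2 * y, by ring⟩
  · rintro ⟨u, v, w, h⟩
    have heven : (2 : ℤ) ∣ u + v + w := by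
      have : Even (u ^ 2 + v ^ 2 + w ^ 2) := h ▸ even_two_mul n
      refine even_iff_two_dvd.mp ?_
      simpa [Int.even_add, Int.even_pow] using this
    by_cases hu : 2 ∣ u <;> by_cases hv : 2 ∣ v
    · obtain ⟨u, rfl⟩ := hu
      obtain ⟨v, rfl⟩ := hv
      obtain ⟨w, rfl⟩ : 2 ∣ w := by omega
      rcases (by omega : 2 ∣ u - v ∨ 2 ∣ u - w ∨ 2 ∣ v - w) with h' | h' | h'
      · exact exists_of_dvd_sub h (dvd_mul_right _ _) (by omega)
      · exact exists_of_dvd_sub (u := 2 * u) (v := 2 * w) (w := 2 * v) (by linarith)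
          (dvd_mul_right _ _) (by omega)
      · exact exists_of_dvd_sub (u := 2 * v) (v := 2 * w) (w := 2 * u) (by linarith)
          (dvd_mul_right _ _) (by omega)
    · exact exists_of_two_dvd_add (u := v) (v := w) (w := u) (by linarith) hu hv (by omega)
    · exact exists_of_two_dvd_add (u := u) (v := w) (w := v) (by linarith) hv hu (by omega)
    · exact exists_of_two_dvd_add h (by omega) hu hv

theorem two_mul_eq_four_pow_mul_iff (n : ℕ) :
    (∃ s t : ℕ, 2 * n = 4 ^ s * (8 * t + 7)) ↔
      ∃ s t : ℕ, n = 2 ^ (2 * s + 1) * (8 * t + 7) := by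
  constructor
  · rintro ⟨s, t, h⟩
    cases s with
    | zero => omega
    | succ s =>
      refine ⟨s, t, ?_⟩
      rw [pow_succ, pow_mul]
      rw [pow_succ] at h
      norm_num
      linarith
  · rintro ⟨s, t, rfl⟩
    refine ⟨s + 1, t, ?_⟩
    rw [pow_succ, pow_mul, pow_succ]
    norm_num
    ring

theorem stmt_0 (n : ℕ) :
    (∃ x y z : ℤ, x ^ 2 + 2 * y ^ 2 + 4 * z ^ 2 = (n : ℤ)) ↔
      ¬ ∃ s t : ℕ, n = 2 ^ (2 * s + 1) * (8 * t + 7) := by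
  rw [exists_sq_add_two_mul_sq_add_four_mul_sq_iff, ← two_mul_eq_four_pow_mul_iff,
    ← sum_three_squares_iff]
  push_cast
  rfl
end

section
/- Every nonnegative integer is represented by the ternary quadratic form x² + 2y² + 3z² over the integers except exactly the integers of the form 2^(2s+1)·(8t+5) for nonnegative integers s and t. -/
open scoped NumberTheorySymbols

/-- An integral ternary form of determinant one with positive leading principal minors
is a sum of three squares of integers at every integer point. -/
theorem exists_three_sq_of_ternary_det_one (a b c r s t : ℤ) (ha : 0 < a)
    (hD : 0 < a * b - r ^ 2)
    (hdet : c * (a * b - r ^ 2) - a * t ^ 2 - b * s ^ 2 + 2 * r * s * t = 1) (x y z : ℤ) :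
    ∃ u v w : ℤ, a * x ^ 2 + b * y ^ 2 + c * z ^ 2 + 2 * r * x * y + 2 * s * x * z
      + 2 * t * y * z = u ^ 2 + v ^ 2 + w ^ 2 := by
  have shift : ∀ m : ℤ, 0 < m → ∀ l : ℤ, ∃ k : ℤ, -m ≤ 2 * (l + k * m) ∧ 2 * (l + k * m) ≤ m := by
    intro m hm l
    refine ⟨-((2 * l + m) / (2 * m)), ?_⟩
    have h1 := Int.emod_nonneg (2 * l + m) (show 2 * m ≠ 0 by omega)
    have h2 := Int.emod_lt_of_pos (2 * l + m) (show 0 < 2 * m by omega)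
    have h3 := Int.mul_ediv_add_emod (2 * l + m) (2 * m)
    constructor <;> nlinarith
  obtain ⟨N, hN⟩ : ∃ N : ℕ, a + (a * b - r ^ 2) ≤ N := ⟨_, Int.self_le_toNat _⟩
  induction N using Nat.strong_induction_on generalizing a b c r s t x y z with
  | _ N ih =>
  obtain ⟨k, hk⟩ := shift a ha r
  -- substitute `x + k y` for `x` to make the `x y` coefficient small
  obtain ⟨b', hb'⟩ : ∃ b', b' = b + 2 * k * r + k ^ 2 * a := ⟨_, rfl⟩
  obtain ⟨r', hr'⟩ : ∃ r', r' = r + k * a := ⟨_, rfl⟩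
  obtain ⟨t', ht'⟩ : ∃ t', t' = t + k * s := ⟨_, rfl⟩
  obtain ⟨D, hDdef⟩ : ∃ D, D = a * b - r ^ 2 := ⟨_, rfl⟩
  have hD' : a * b' - r' ^ 2 = D := by subst hb' hr' hDdef; ring
  -- substitute `y + l z` for `y` to make the off-diagonal minor small
  obtain ⟨l, hl⟩ := shift D (by omega) (a * t' - r' * s)
  obtain ⟨c', hc'⟩ : ∃ c', c' = c + 2 * l * t' + l ^ 2 * b' := ⟨_, rfl⟩
  obtain ⟨s', hs'⟩ : ∃ s', s' = s + l * r' := ⟨_, rfl⟩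
  obtain ⟨t'', ht''⟩ : ∃ t'', t'' = t' + l * b' := ⟨_, rfl⟩
  have hE : a * t'' - r' * s' = a * t' - r' * s + l * D := by subst ht'' hs' hD'; ring
  rw [← hE] at hl
  rw [← hr'] at hk
  have hdet' : c' * (a * b' - r' ^ 2) - a * t'' ^ 2 - b' * s' ^ 2 + 2 * r' * s' * t'' = 1 := by
    rw [← hdet]; subst hc' hs' ht'' hb' hr' ht'; ring
  have heq : ∀ x y z : ℤ, a * x ^ 2 + b * y ^ 2 + c * z ^ 2 + 2 * r * x * y + 2 * s * x * z
      + 2 * t * y * z = a * (x - k * y) ^ 2 + b' * (y - l * z) ^ 2 + c' * z ^ 2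
        + 2 * r' * (x - k * y) * (y - l * z) + 2 * s' * (x - k * y) * z
        + 2 * t'' * (y - l * z) * z := by
    intro x y z; subst hc' hs' ht'' hb' hr' ht'; ring
  rw [heq]
  generalize x - k * y = X
  generalize y - l * z = Y
  have hF : D * (a * c' - s' ^ 2) = a + (a * t'' - r' * s') ^ 2 := by
    have : a * (c' * (a * b' - r' ^ 2) - a * t'' ^ 2 - b' * s' ^ 2 + 2 * r' * s' * t'') = a * 1 := by
      rw [hdet']
    rw [← hD']; linear_combination this
  have hDpos : 0 < D := by omega
  have hFpos : 0 < a * c' - s' ^ 2 := by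
    by_contra h
    nlinarith [sq_nonneg (a * t'' - r' * s')]
  have hbpos : 0 < b' := by
    by_contra h
    nlinarith [sq_nonneg r']
  clear heq hE hc' hs' ht'' hb' hr' ht' hdet
  rw [← hDdef] at hN
  by_cases hba : b' < a
  · obtain ⟨u, v, w, h⟩ := ih (b' + D).toNat (by omega) b' a c' r' t'' s' hbpos
      (by linarith) (by linarith) Y X z (by rw [Int.toNat_of_nonneg (by omega)]; linarith)
    exact ⟨u, v, w, by rw [← h]; ring⟩
  by_cases hFD : a * c' - s' ^ 2 < D
  · obtain ⟨u, v, w, h⟩ := ih (a + (a * c' - s' ^ 2)).toNat (by omega) a c' b' s' r' t'' ha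
      hFpos (by linarith) X z Y (by rw [Int.toNat_of_nonneg (by omega)])
    exact ⟨u, v, w, by rw [← h]; ring⟩
  have hr2 : 4 * r' ^ 2 ≤ a ^ 2 := by nlinarith
  have hE2 : 4 * (a * t'' - r' * s') ^ 2 ≤ D ^ 2 := by nlinarith
  have h1 : 3 * D ^ 2 ≤ 4 * a := by nlinarith
  have h2 : 3 * a ^ 2 ≤ 4 * D := by nlinarith
  have hD1 : D = 1 := by
    have : D < 2 := by nlinarith
    omega
  have ha1 : a = 1 := by subst hD1; nlinarith
  subst ha1 hD1
  have hr0 : r' = 0 := by omega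
  subst hr0
  have hb1 : b' = 1 := by linarith
  have ht0 : t'' = 0 := by omega
  subst hb1 ht0
  exact ⟨X + s' * z, Y, z, by linear_combination z ^ 2 * hdet'⟩

/-- If `-d` is a square modulo `d * n - 1`, then `n` is a sum of three squares. -/
theorem exists_three_sq_of_dvd {n d e : ℤ} (hd : 0 < d) (hm : 0 < d * n - 1)
    (h : d * n - 1 ∣ e ^ 2 + d) : ∃ u v w : ℤ, n = u ^ 2 + v ^ 2 + w ^ 2 := by
  obtain ⟨b, hb⟩ := h
  have hD : (d * n - 1) * b - e ^ 2 = d := by linarith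
  obtain ⟨u, v, w, h⟩ := exists_three_sq_of_ternary_det_one (d * n - 1) b n e 0 1 hm
    (by omega) (by rw [hD]; ring) 0 0 1
  exact ⟨u, v, w, by rw [← h]; ring⟩

theorem exists_dvd_sq_add_of_jacobiSym {p d : ℕ} (hp : p.Prime) (h : J(-d | p) = 1) :
    ∃ e : ℤ, (p : ℤ) ∣ e ^ 2 + d := by
  have := Fact.mk hp
  obtain ⟨e, he⟩ := ZMod.isSquare_of_jacobiSym_eq_one h
  obtain ⟨e, rfl⟩ := ZMod.intCast_surjective e
  refine ⟨e, (ZMod.intCast_zmod_eq_zero_iff_dvd _ p).mp ?_⟩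
  push_cast at he ⊢
  rw [sq, ← he]; ring

theorem jacobiSym_neg_eq {p d : ℕ} (h : p % 4 = 1 ∧ d % 2 = 1 ∨ p % 4 = 3 ∧ d % 4 = 3) :
    J(-d | p) = J(p | d) := by
  rcases h with ⟨hp, hd⟩ | ⟨hp, hd⟩
  · rw [jacobiSym.neg _ (Nat.odd_iff.mpr (by omega)), ZMod.χ₄_nat_one_mod_four hp, one_mul,
      jacobiSym.quadratic_reciprocity_one_mod_four hp (Nat.odd_iff.mpr hd)]
  · rw [jacobiSym.neg _ (Nat.odd_iff.mpr (by omega)), ZMod.χ₄_nat_three_mod_four hp,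
      jacobiSym.quadratic_reciprocity_three_mod_four hd hp, neg_one_mul, neg_neg]

theorem exists_three_sq_of_mod_four_eq_two {n : ℕ} (hn : n % 4 = 2) :
    ∃ u v w : ℤ, (n : ℤ) = u ^ 2 + v ^ 2 + w ^ 2 := by
  have hco : (n - 1).Coprime (4 * n) := by
    refine Nat.Coprime.mul_right ?_ ?_
    · have : Odd (n - 1) := Nat.odd_iff.mpr (by omega)
      exact (Nat.coprime_two_right.mpr this).pow_right 2
    · exact Nat.coprime_self_sub_left (by omega) |>.mpr (Nat.coprime_one_left n)
  obtain ⟨p, hgt, hp, hmod⟩ :=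
    Nat.forall_exists_prime_gt_and_modEq (n - 1) (show 4 * n ≠ 0 by omega) hco
  obtain ⟨j, hj⟩ := (Nat.modEq_iff_dvd' hgt.le).mp hmod.symm
  obtain ⟨d, hd⟩ : ∃ d, d = 4 * j + 1 := ⟨_, rfl⟩
  have hpd : d * n = p + 1 := by
    have : p = 4 * n * j + (n - 1) := by omega
    rw [this, hd, add_mul, one_mul, show 4 * j * n = 4 * n * j by ring]; omega
  have hp4 : p % 4 = 1 := by
    have : p = 4 * (n * j) + (n - 1) := by rw [← mul_assoc]; omega
    omega
  have hJ : J(-d | p) = 1 := by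
    rw [jacobiSym_neg_eq (by omega)]
    have h1 : J(-1 * p | d) = 1 := by
      rw [jacobiSym.mod_left' (a₂ := 1), jacobiSym.one_left]
      rw [show (-1 * p : ℤ) = 1 + d * (-n) by
        have : (d : ℤ) * n = p + 1 := by exact_mod_cast hpd
        linear_combination this]
      simp
    rwa [jacobiSym.mul_left, jacobiSym.at_neg_one (Nat.odd_iff.mpr (by omega)),
      ZMod.χ₄_nat_one_mod_four (by omega), one_mul] at h1
  obtain ⟨e, he⟩ := exists_dvd_sq_add_of_jacobiSym hp hJ
  have hpz : (d : ℤ) * n - 1 = p := by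
    have : (d : ℤ) * n = p + 1 := by exact_mod_cast hpd
    omega
  exact exists_three_sq_of_dvd (d := d) (by omega) (by have := hp.pos; omega) (hpz ▸ he)

theorem exists_three_sq_of_odd {n : ℕ} (hn : n % 8 = 1 ∨ n % 8 = 3 ∨ n % 8 = 5) :
    ∃ u v w : ℤ, (n : ℤ) = u ^ 2 + v ^ 2 + w ^ 2 := by
  obtain ⟨c, q, hq, hc⟩ : ∃ c q : ℕ, c * n = 2 * q + 1 ∧
      (c = 1 ∧ q % 4 = 1 ∨ c = 3 ∧ q % 2 = 1) := by
    rcases hn with h | h | h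
    · exact ⟨3, (3 * n - 1) / 2, by omega, by omega⟩
    · exact ⟨1, (n - 1) / 2, by omega, by omega⟩
    · exact ⟨3, (3 * n - 1) / 2, by omega, by omega⟩
  have hco : q.Coprime (4 * n) := by
    refine Nat.Coprime.mul_right ?_ ?_
    · have : Odd q := Nat.odd_iff.mpr (by omega)
      exact (Nat.coprime_two_right.mpr this).pow_right 2
    · refine Nat.Coprime.coprime_dvd_right (Dvd.intro_left c hq) ?_
      simp
  obtain ⟨p, hgt, hp, hmod⟩ :=
    Nat.forall_exists_prime_gt_and_modEq q (show 4 * n ≠ 0 by omega) hco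
  obtain ⟨j, hj⟩ := (Nat.modEq_iff_dvd' hgt.le).mp hmod.symm
  obtain ⟨d, hd⟩ : ∃ d, d = 8 * j + c := ⟨_, rfl⟩
  have hpq : p = 4 * (n * j) + q := by rw [← mul_assoc]; omega
  have hpd : d * n = 2 * p + 1 := by
    rw [hpq, hd, add_mul, hq]; ring
  have hpz : (d : ℤ) * n - 1 = 2 * p := by
    have : (d : ℤ) * n = 2 * p + 1 := by exact_mod_cast hpd
    omega
  have hJ : J(-d | p) = 1 := by
    rw [jacobiSym_neg_eq (by omega)]
    have h1 : J(-2 * p | d) = 1 := by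
      rw [jacobiSym.mod_left' (a₂ := 1), jacobiSym.one_left]
      rw [show (-2 * p : ℤ) = 1 + d * (-n) by linear_combination hpz]
      simp
    have h2 : ZMod.χ₈' d = 1 := by
      rw [ZMod.χ₈'_nat_eq_if_mod_eight, if_neg (by omega), if_pos (by omega)]
    rwa [jacobiSym.mul_left, jacobiSym.at_neg_two (Nat.odd_iff.mpr (by omega)), h2,
      one_mul] at h1
  obtain ⟨e, he⟩ := exists_dvd_sq_add_of_jacobiSym hp hJ
  obtain ⟨e', he', hpar⟩ : ∃ e' : ℤ, (p : ℤ) ∣ e' ^ 2 + d ∧ e' % 2 = 1 := by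
    rcases Int.emod_two_eq_zero_or_one e with h | h
    · refine ⟨e + p, ?_, by omega⟩
      rw [show (e + p) ^ 2 + d = e ^ 2 + d + p * (2 * e + p) by ring]
      exact dvd_add he (dvd_mul_right _ _)
    · exact ⟨e, he, h⟩
  have h2 : (2 : ℤ) ∣ e' ^ 2 + d := by
    have : e' ^ 2 % 2 = 1 := by rw [sq, Int.mul_emod, hpar]; rfl
    omega
  have hcop : IsCoprime (2 : ℤ) p := by
    rw [Int.isCoprime_iff_gcd_eq_one]
    exact_mod_cast (Nat.coprime_two_left.mpr (Nat.odd_iff.mpr (by omega)) : Nat.Coprime 2 p)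
  exact exists_three_sq_of_dvd (d := d) (by omega) (by have := hp.pos; omega)
    (hpz ▸ hcop.mul_dvd h2 he')

theorem sq_emod_two (x : ℤ) : x ^ 2 % 2 = x % 2 := by
  rcases Int.emod_two_eq_zero_or_one x with h | h <;> simp [sq, Int.mul_emod, h]

theorem emod_three_of_sq_add_sq_add_sq {A B C : ℤ} (h : (A ^ 2 + B ^ 2 + C ^ 2) % 3 = 0) :
    (A - B) % 3 = 0 ∨ (A + B) % 3 = 0 := by
  have sq3 : ∀ x : ℤ, x % 3 = 0 ∧ x ^ 2 % 3 = 0 ∨ (x % 3 = 1 ∨ x % 3 = 2) ∧ x ^ 2 % 3 = 1 := by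
    intro x
    have : x % 3 = 0 ∨ x % 3 = 1 ∨ x % 3 = 2 := by omega
    rcases this with h | h | h <;> simp [sq, Int.mul_emod, h]
  generalize hA : A ^ 2 = a, hB : B ^ 2 = b, hC : C ^ 2 = c at h
  have hA3 := hA ▸ sq3 A
  have hB3 := hB ▸ sq3 B
  have hC3 := hC ▸ sq3 C
  clear sq3 hA hB hC
  rcases hA3 with ⟨_, _⟩ | ⟨_, _⟩ <;> rcases hB3 with ⟨_, _⟩ | ⟨_, _⟩ <;> omega

/-- The vectors `(1, 1, 1)`, `(1, -1, 0)`, `(1, 1, -2)` are orthogonal, with norms `3`, `2`, `6`;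
expanding a representation of `6 * n` as a sum of three squares in them represents `n`. -/
theorem exists_sq_add_two_sq_add_three_sq {n A B C : ℤ} (h : 6 * n = A ^ 2 + B ^ 2 + C ^ 2) :
    ∃ x y z : ℤ, x ^ 2 + 2 * y ^ 2 + 3 * z ^ 2 = n := by
  wlog hC : C % 2 = 0 generalizing A B C
  · have hA2 := sq_emod_two A
    have hB2 := sq_emod_two B
    have hC2 := sq_emod_two C
    by_cases hB : B % 2 = 0
    · exact this (A := A) (B := C) (C := B) (by linarith) hB
    · exact this (A := B) (B := C) (C := A) (by linarith) (by omega)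
  have hAB : (A - B) % 2 = 0 := by
    have hA2 := sq_emod_two A
    have hB2 := sq_emod_two B
    have hC2 := sq_emod_two C
    omega
  have hAB3 := emod_three_of_sq_add_sq_add_sq (A := A) (B := B) (C := C) (by omega)
  have hAC3 := emod_three_of_sq_add_sq_add_sq (A := A) (B := C) (C := B) (by omega)
  obtain ⟨B', hB', z, hz⟩ : ∃ B', B' ^ 2 = B ^ 2 ∧ ∃ z, A - B' = 6 * z := by
    rcases hAB3 with h3 | h3
    · exact ⟨B, rfl, (A - B) / 6, by clear h; omega⟩
    · exact ⟨-B, by ring, (A + B) / 6, by clear h; omega⟩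
  obtain ⟨C', hC', hCA, hC'2⟩ : ∃ C', C' ^ 2 = C ^ 2 ∧ (A - C') % 3 = 0 ∧ C' % 2 = 0 := by
    rcases hAC3 with h3 | h3
    · exact ⟨C, rfl, h3, hC⟩
    · exact ⟨-C, by ring, by rwa [sub_neg_eq_add], by clear h; omega⟩
  rw [← hB', ← hC'] at h
  clear hB' hC' hAB3 hAC3 hAB hC
  obtain ⟨y, hy⟩ : ∃ y, A + B' + C' = 6 * y := ⟨(A + B' + C') / 6, by clear h; omega⟩
  obtain ⟨x, hx⟩ : ∃ x, A + B' - 2 * C' = 6 * x := ⟨(A + B' - 2 * C') / 6, by clear h; omega⟩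
  refine ⟨x, y, z, ?_⟩
  rw [show A = x + 2 * y + 3 * z by linarith, show B' = x + 2 * y - 3 * z by linarith,
    show C' = 2 * y - 2 * x by linarith] at h
  linarith

theorem not_sq_add_two_sq_add_three_sq (s t : ℕ) (x y z : ℤ) :
    x ^ 2 + 2 * y ^ 2 + 3 * z ^ 2 ≠ 2 ^ (2 * s + 1) * (8 * t + 5) := by
  induction s generalizing x y z with
  | zero =>
    intro h
    have h16 : ∀ x y z : ZMod 16, x ^ 2 + 2 * y ^ 2 + 3 * z ^ 2 ≠ 10 := by decide
    apply h16 x y z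
    have := congrArg (Int.cast : ℤ → ZMod 16) h
    push_cast at this
    rw [this]
    linear_combination (t : ZMod 16) * (by decide : (16 : ZMod 16) = 0)
  | succ s ih =>
    intro h
    rw [show 2 * (s + 1) + 1 = 2 * s + 1 + 2 by ring, pow_add] at h
    have h8 : (x ^ 2 + 2 * y ^ 2 + 3 * z ^ 2) % 8 = 0 := by
      rw [h, pow_succ]
      ring_nf
      omega
    have sq8 : ∀ x : ℤ, x % 2 = 0 ∧ x ^ 2 % 4 = 0 ∨ x % 2 = 1 ∧ x ^ 2 % 8 = 1 := by
      intro x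
      rcases Int.emod_two_eq_zero_or_one x with hx | hx
      · obtain ⟨k, rfl⟩ : ∃ k, x = 2 * k := ⟨x / 2, by omega⟩
        left
        refine ⟨hx, ?_⟩
        ring_nf
        omega
      · have := Int.eight_dvd_sq_sub_one_of_odd (Int.odd_iff.mpr hx)
        omega
    have hx8 := sq8 x
    have hy8 := sq8 y
    have hz8 := sq8 z
    obtain ⟨X, rfl⟩ : ∃ k, x = 2 * k := ⟨x / 2, by omega⟩
    obtain ⟨Y, rfl⟩ : ∃ k, y = 2 * k := ⟨y / 2, by omega⟩
    obtain ⟨Z, rfl⟩ : ∃ k, z = 2 * k := ⟨z / 2, by omega⟩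
    exact ih X Y Z (by linarith)

theorem stmt_1 (n : ℕ) :
    (∃ x y z : ℤ, x ^ 2 + 2 * y ^ 2 + 3 * z ^ 2 = (n : ℤ)) ↔
      ¬ ∃ s t : ℕ, n = 2 ^ (2 * s + 1) * (8 * t + 5) := by
  constructor
  · rintro ⟨x, y, z, h⟩ ⟨s, t, rfl⟩
    exact not_sq_add_two_sq_add_three_sq s t x y z (by rw [h]; push_cast; rfl)
  induction n using Nat.strong_induction_on with
  | _ n ih =>
  intro hn
  rcases Nat.eq_zero_or_pos n with rfl | hpos
  · exact ⟨0, 0, 0, by norm_num⟩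
  have hcases : n % 2 = 1 ∨ n % 4 = 2 ∨ n % 4 = 0 := by omega
  rcases hcases with h | h | h
  · obtain ⟨u, v, w, h⟩ := exists_three_sq_of_mod_four_eq_two (show (6 * n) % 4 = 2 by omega)
    exact exists_sq_add_two_sq_add_three_sq (by rw [← h]; push_cast; rfl)
  · obtain ⟨m, rfl⟩ : ∃ m, n = 2 * m := ⟨n / 2, by omega⟩
    have hm : m % 8 ≠ 5 := fun h5 ↦ hn ⟨0, m / 8, by omega⟩
    obtain ⟨u, v, w, h⟩ := exists_three_sq_of_odd
      (show (3 * m) % 8 = 1 ∨ (3 * m) % 8 = 3 ∨ (3 * m) % 8 = 5 by omega)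
    refine exists_sq_add_two_sq_add_three_sq (A := 2 * u) (B := 2 * v) (C := 2 * w) ?_
    push_cast at h ⊢
    linarith
  · obtain ⟨m, rfl⟩ : ∃ m, n = 4 * m := ⟨n / 4, by omega⟩
    obtain ⟨x, y, z, h⟩ := ih m (by omega) (by
      rintro ⟨s, t, rfl⟩
      exact hn ⟨s + 1, t, by ring⟩)
    exact ⟨2 * x, 2 * y, 2 * z, by push_cast; linarith⟩
end

section
/- Let n be a positive integer not of the form 5^(2s+1)·(5t±2) for nonnegative integers s, t. If n ≡ 0 (mod 8), then there exist integers a₁, a₂, a₃, all odd, with a₁² + 2a₂² + 5a₃² = n. -/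
/-- The quadratic form `((c + 2u)² + 2(c + 2v)² + 5c²) / 4`. -/
def latticeForm (u c v : ℤ) : ℤ := u ^ 2 + c * u + 2 * c ^ 2 + 2 * c * v + 2 * v ^ 2

lemma four_mul_latticeForm (u c v : ℤ) :
    4 * latticeForm u c v = (c + 2 * u) ^ 2 + 2 * (c + 2 * v) ^ 2 + 5 * c ^ 2 := by
  unfold latticeForm; ring

lemma exists_abs_sub_le (w x : ℤ) (hw : 0 < w) :
    ∃ k : ℤ, |x - 2 * w * k| ≤ w := by
  refine ⟨(x + w) / (2 * w), ?_⟩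
  have h1 := Int.emod_add_mul_ediv (x + w) (2 * w)
  have h2 := Int.emod_nonneg (x + w) (by omega : 2 * w ≠ 0)
  have h3 := Int.emod_lt_of_pos (x + w) (by omega : 0 < 2 * w)
  rw [abs_le]
  constructor <;> linarith

lemma exists_half_shift (w p : ℤ) :
    ∃ e : ℤ, (p + w - 2 * w * e) ^ 2 = (w - |p|) ^ 2 := by
  rcases abs_cases p with ⟨h, _⟩ | ⟨h, _⟩
  · exact ⟨1, by rw [h]; ring⟩
  · exact ⟨0, by rw [h]; ring⟩

/-- The form `latticeForm` is Euclidean. -/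
lemma exists_latticeForm_lt (w u c v : ℤ) (hw : 0 < w) :
    ∃ u₀ c₀ v₀ : ℤ, latticeForm (u - w * u₀) (c - w * c₀) (v - w * v₀) < w ^ 2 := by
  have h1 := Int.emod_add_mul_ediv c w
  have h2 := Int.emod_nonneg c hw.ne'
  have h3 := Int.emod_lt_of_pos c hw
  set d := c % w
  set c₀ := c / w
  obtain ⟨k, hk⟩ := exists_abs_sub_le w (d + 2 * u) hw
  obtain ⟨l, hl⟩ := exists_abs_sub_le w (d + 2 * v) hw
  obtain ⟨e, he⟩ := exists_half_shift w (d + 2 * u - 2 * w * k)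
  obtain ⟨f, hf⟩ := exists_half_shift w (d + 2 * v - 2 * w * l)
  by_contra! hcon
  have A := hcon k c₀ l
  have B := hcon (k + e - 1) (c₀ + 1) (l + f - 1)
  have A4 := four_mul_latticeForm (u - w * k) (c - w * c₀) (v - w * l)
  have B4 := four_mul_latticeForm (u - w * (k + e - 1)) (c - w * (c₀ + 1)) (v - w * (l + f - 1))
  have hc : c = d + w * c₀ := h1.symm
  rw [show c - w * c₀ + 2 * (u - w * k) = d + 2 * u - 2 * w * k by rw [hc]; ring,
    show c - w * c₀ + 2 * (v - w * l) = d + 2 * v - 2 * w * l by rw [hc]; ring,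
    show c - w * c₀ = d by rw [hc]; ring, ← sq_abs, ← sq_abs (d + 2 * v - 2 * w * l)] at A4
  rw [show c - w * (c₀ + 1) + 2 * (u - w * (k + e - 1))
      = d + 2 * u - 2 * w * k + w - 2 * w * e by rw [hc]; ring,
    show c - w * (c₀ + 1) + 2 * (v - w * (l + f - 1))
      = d + 2 * v - 2 * w * l + w - 2 * w * f by rw [hc]; ring,
    show c - w * (c₀ + 1) = d - w by rw [hc]; ring, he, hf] at B4
  rw [show c - w * c₀ = d by rw [hc]; ring] at A
  rw [show c - w * (c₀ + 1) = d - w by rw [hc]; ring] at B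
  have p0 := abs_nonneg (d + 2 * u - 2 * w * k)
  have r0 := abs_nonneg (d + 2 * v - 2 * w * l)
  set p := |d + 2 * u - 2 * w * k|
  set r := |d + 2 * v - 2 * w * l|
  have hp := mul_nonneg p0 (sub_nonneg.2 hk)
  have hr := mul_nonneg r0 (sub_nonneg.2 hl)
  rcases h2.eq_or_lt with hd | hd
  · rw [← hd] at A A4
    nlinarith
  · have := mul_pos hd (sub_pos.2 h3)
    nlinarith

/-- The Davenport–Cassels descent for `latticeForm`. -/
lemma exists_latticeForm_eq (N : ℤ) (w : ℕ) (hw : 0 < w) (u c v : ℤ)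
    (h : latticeForm u c v = N * (w : ℤ) ^ 2) : ∃ u' c' v' : ℤ, latticeForm u' c' v' = N := by
  induction w using Nat.strong_induction_on generalizing u c v with
  | _ w ih =>
    have hw' : (0 : ℤ) < w := by exact_mod_cast hw
    obtain ⟨p, q, r, hlt⟩ := exists_latticeForm_lt w u c v hw'
    set T : ℤ := 2 * u * p + c * p + u * q + 4 * c * q + 2 * c * r + 2 * v * q + 4 * v * r with hT
    set t : ℤ := N * w - T + w * latticeForm p q r with ht
    have key : latticeForm (u - w * p) (c - w * q) (v - w * r) = w * t := by
      rw [ht, hT]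
      unfold latticeForm at h ⊢
      linear_combination h
    have h4 := four_mul_latticeForm (u - w * p) (c - w * q) (v - w * r)
    rw [key] at hlt h4
    have ht0 : 0 ≤ t := by
      by_contra! hneg
      nlinarith [sq_nonneg (c - w * q + 2 * (u - w * p)), sq_nonneg (c - w * q + 2 * (v - w * r)),
        sq_nonneg (c - w * q)]
    have htw : t < w := by nlinarith
    rcases ht0.eq_or_lt with h0 | hpos
    · rw [← h0] at h4
      have hc : c - w * q = 0 := by
        apply pow_eq_zero_iff two_ne_zero |>.1
        nlinarith [sq_nonneg (c - w * q + 2 * (u - w * p)), sq_nonneg (c - w * q),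
          sq_nonneg (c - w * q + 2 * (v - w * r))]
      rw [hc] at h4
      have hu : u - w * p = 0 := by
        apply pow_eq_zero_iff two_ne_zero |>.1
        nlinarith [sq_nonneg (u - w * p), sq_nonneg (v - w * r)]
      have hv : v - w * r = 0 := by
        apply pow_eq_zero_iff two_ne_zero |>.1
        nlinarith [sq_nonneg (u - w * p), sq_nonneg (v - w * r)]
      refine ⟨p, q, r, ?_⟩
      have e1 : u = w * p := by linarith
      have e2 : c = w * q := by linarith
      have e3 : v = w * r := by linarith
      have : (w : ℤ) ^ 2 * latticeForm p q r = w ^ 2 * N := by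
        rw [e1, e2, e3] at h
        unfold latticeForm at h ⊢
        linear_combination h
      exact mul_left_cancel₀ (by positivity) this
    · lift t to ℕ using ht0 with t' ht'
      refine ih t' (by exact_mod_cast htw) (by exact_mod_cast hpos)
        ((latticeForm p q r - N) * u + (2 * N * w - T) * p)
        ((latticeForm p q r - N) * c + (2 * N * w - T) * q)
        ((latticeForm p q r - N) * v + (2 * N * w - T) * r) ?_
      have polar : ∀ a b : ℤ, latticeForm (a * u + b * p) (a * c + b * q) (a * v + b * r)
          = a ^ 2 * latticeForm u c v + a * b * T + b ^ 2 * latticeForm p q r := by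
        intro a b
        rw [hT]; unfold latticeForm; ring
      rw [polar, h, ht]
      ring

lemma exists_int_of_exists_rat (N w x y z : ℤ) (hw : w ≠ 0)
    (h : x ^ 2 + 2 * y ^ 2 + 5 * z ^ 2 = 4 * N * w ^ 2) :
    ∃ a b c : ℤ, a ^ 2 + 2 * b ^ 2 + 5 * c ^ 2 = 4 * N := by
  obtain ⟨u, c, v, e⟩ := exists_latticeForm_eq N (2 * w).natAbs (by omega) (x - z) (2 * z) (y - z)
    (by
      rw [Int.natCast_natAbs, sq_abs]
      unfold latticeForm
      linear_combination h)
  exact ⟨c + 2 * u, c + 2 * v, c, by rw [← e, four_mul_latticeForm]⟩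

/-- Reflections turn a representation of `m` into a representation of `4m` by odd integers. -/
lemma exists_odd_of_quarter (m A B C : ℤ) (h : A ^ 2 + 2 * B ^ 2 + 5 * C ^ 2 = m) (hm : m % 2 = 0)
    (h8 : m % 8 = 0 → Odd A) :
    ∃ a b c : ℤ, a ^ 2 + 2 * b ^ 2 + 5 * c ^ 2 = 4 * m ∧ Odd a ∧ Odd b ∧ Odd c := by
  have refl₁ : ∀ A B C s : ℤ, A ^ 2 + 2 * B ^ 2 + 5 * C ^ 2 = m → Odd s →
      2 * s = A + 2 * B + 5 * C →
      ∃ a b c : ℤ, a ^ 2 + 2 * b ^ 2 + 5 * c ^ 2 = 4 * m ∧ Odd a ∧ Odd b ∧ Odd c := by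
    intro A B C s h hs e
    refine ⟨2 * A - s, 2 * B - s, 2 * C - s, by linear_combination 4 * h + 4 * s * e, ?_, ?_, ?_⟩ <;>
    · rw [Int.odd_iff] at hs ⊢
      omega
  have refl₂ : ∀ A B C s : ℤ, (2 * A) ^ 2 + 2 * B ^ 2 + 5 * (2 * C) ^ 2 = m → Odd s →
      2 * s = 3 * A + B + 5 * C →
      ∃ a b c : ℤ, a ^ 2 + 2 * b ^ 2 + 5 * c ^ 2 = 4 * m ∧ Odd a ∧ Odd b ∧ Odd c := by
    intro A B C s h hs e
    refine ⟨4 * A - 3 * s, 2 * B - s, 4 * C - s, by linear_combination 4 * h + 8 * s * e,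
      ?_, ?_, ?_⟩ <;>
    · rw [Int.odd_iff] at hs ⊢
      omega
  have par : (A % 2 = 1 ∧ C % 2 = 1) ∨ (A % 2 = 0 ∧ C % 2 = 0) := by
    rcases Int.even_or_odd' A with ⟨x, rfl | rfl⟩ <;> rcases Int.even_or_odd' C with ⟨z, rfl | rfl⟩
    · right; omega
    · ring_nf at h; omega
    · ring_nf at h; omega
    · left; omega
  rcases par with ⟨hA, hC⟩ | ⟨hA, hC⟩
  · by_cases hs : Odd ((A + 2 * B + 5 * C) / 2)
    · exact refl₁ A B C _ h hs (by omega)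
    · refine refl₁ A B (-C) ((A + 2 * B + 5 * (-C)) / 2) (by linear_combination h) ?_ (by omega)
      rw [Int.odd_iff] at hs ⊢
      omega
  · obtain ⟨x, rfl⟩ : ∃ x, A = 2 * x := ⟨A / 2, by omega⟩
    obtain ⟨z, rfl⟩ : ∃ z, C = 2 * z := ⟨C / 2, by omega⟩
    have h8' : m % 8 ≠ 0 := fun h0 => by
      have := h8 h0
      rw [Int.odd_iff] at this
      omega
    by_cases hs : Odd (x + B + 5 * z)
    · exact refl₁ (2 * x) B (2 * z) _ h hs (by ring)
    · rw [Int.odd_iff] at hs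
      have hB : Odd B := by
        rw [Int.odd_iff]
        by_contra hB
        obtain ⟨y, rfl⟩ : ∃ y, B = 2 * y := ⟨B / 2, by omega⟩
        obtain ⟨k, hk⟩ : ∃ k, x = z + 2 * k := ⟨(x - z) / 2, by omega⟩
        subst hk
        apply h8'
        have hzz : z * z % 2 = z % 2 := by
          rcases Int.even_or_odd' z with ⟨j, rfl | rfl⟩ <;> ring_nf <;> omega
        ring_nf at h
        omega
      rw [Int.odd_iff] at hB
      by_cases hs2 : Odd ((3 * x + B + 5 * z) / 2)
      · exact refl₂ x B z _ h hs2 (by omega)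
      · refine refl₂ x (-B) z ((3 * x + -B + 5 * z) / 2) (by linear_combination h) ?_ (by omega)
        rw [Int.odd_iff] at hs2 ⊢
        omega

lemma parity_of_eight_dvd (n a b c : ℤ) (h : a ^ 2 + 2 * b ^ 2 + 5 * c ^ 2 = n) (h8 : n % 8 = 0) :
    (Odd a ∧ Odd b ∧ Odd c) ∨ ∃ A B C : ℤ, A ^ 2 + 2 * B ^ 2 + 5 * C ^ 2 = n / 4 := by
  have hsq : ∀ x : ℤ, (x % 2 = 0 ∧ x ^ 2 % 4 = 0) ∨ (x % 2 = 1 ∧ x ^ 2 % 8 = 1) := by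
    intro x
    rcases Int.even_or_odd' x with ⟨k, rfl | rfl⟩
    · left; ring_nf; omega
    · right
      have : k * k % 2 = k % 2 := by
        rcases Int.even_or_odd' k with ⟨j, rfl | rfl⟩ <;> ring_nf <;> omega
      ring_nf at this ⊢
      omega
  simp only [Int.odd_iff]
  have ha := hsq a
  have hb := hsq b
  have hc := hsq c
  by_cases hodd : a % 2 = 1
  · left; omega
  · right
    obtain ⟨x, rfl⟩ : ∃ x, a = 2 * x := ⟨a / 2, by omega⟩
    obtain ⟨y, rfl⟩ : ∃ y, b = 2 * y := ⟨b / 2, by omega⟩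
    obtain ⟨z, rfl⟩ : ∃ z, c = 2 * z := ⟨c / 2, by omega⟩
    exact ⟨x, y, z, by ring_nf at h ⊢; omega⟩

/-- A congruence version of Legendre's theorem, at a point small enough to give a solution. -/
lemma conic_of_small {a b c X Z W : ℤ} (ha : 0 < a) (hb : 0 < b) (hc : 0 < c)
    (bX : X ^ 2 < b * c) (bZ : Z ^ 2 < a * c) (bW : W ^ 2 ≤ a * b)
    (hnz : X ≠ 0 ∨ Z ≠ 0 ∨ W ≠ 0) (hdvd : a * b * c ∣ a * X ^ 2 - b * Z ^ 2 - c * W ^ 2) :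
    ∃ X Z W : ℤ, X ≠ 0 ∧ a * X ^ 2 = b * Z ^ 2 + c * W ^ 2 := by
  obtain ⟨k, hk⟩ := hdvd
  have habc : 0 < a * b * c := by positivity
  have eX : 0 ≤ a * X ^ 2 := by positivity
  have eZ : 0 ≤ b * Z ^ 2 := by positivity
  have eW : 0 ≤ c * W ^ 2 := by positivity
  have k1 : k < 1 := by
    by_contra! h
    have h1 := mul_lt_mul_of_pos_left bX ha
    have h2 := mul_le_mul_of_nonneg_left h habc.le
    linarith
  have k2 : -2 < k := by
    by_contra! h
    have h1 := mul_lt_mul_of_pos_left bZ hb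
    have h2 := mul_le_mul_of_nonneg_left h habc.le
    have h3 := mul_le_mul_of_nonneg_left bW hc.le
    linarith
  obtain rfl | rfl : k = 0 ∨ k = -1 := by omega
  · refine ⟨X, Z, W, ?_, by linear_combination hk⟩
    rintro rfl
    have hZ0 : b * Z ^ 2 = 0 := by linarith
    have hW0 : c * W ^ 2 = 0 := by linarith
    simp_all [ne_of_gt]
  · refine ⟨X ^ 2 + b * c, Z * X + c * W, W * X - b * Z, by positivity, ?_⟩
    linear_combination (X ^ 2 + b * c) * hk

/-- **Legendre's theorem** on conics. -/
lemma legendre_conic (a b c : ℕ) (α β γ : ℤ) (hab : a.Coprime b) (hac : a.Coprime c)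
    (hbc : b.Coprime c) (ha : 0 < a) (hb : 0 < b) (hc : 0 < c)
    (hα : (a : ℤ) ∣ b * α ^ 2 + c) (hβ : (b : ℤ) ∣ a * β ^ 2 - c) (hγ : (c : ℤ) ∣ b * γ ^ 2 - a)
    (nsq_bc : ¬ IsSquare (b * c)) (nsq_ac : ¬ IsSquare (a * c)) :
    ∃ X Z W : ℤ, X ≠ 0 ∧ a * X ^ 2 = b * Z ^ 2 + c * W ^ 2 := by
  have : NeZero a := ⟨ha.ne'⟩
  have : NeZero b := ⟨hb.ne'⟩
  have : NeZero c := ⟨hc.ne'⟩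
  let S := Finset.range ((b * c).sqrt + 1) ×ˢ Finset.range ((a * c).sqrt + 1) ×ˢ
    Finset.range ((a * b).sqrt + 1)
  let f : ℕ × ℕ × ℕ → ZMod a × ZMod b × ZMod c := fun t =>
    ((t.2.1 - α * t.2.2 : ZMod a), (t.1 - β * t.2.2 : ZMod b), (t.2.1 - γ * t.1 : ZMod c))
  have hcard : (Finset.univ : Finset (ZMod a × ZMod b × ZMod c)).card < S.card := by
    simp only [S, Finset.card_univ, Fintype.card_prod, ZMod.card, Finset.card_product,
      Finset.card_range]
    apply lt_of_pow_lt_pow_left₀ 2 (Nat.zero_le _)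
    have h1 := Nat.lt_succ_sqrt' (b * c)
    have h2 := Nat.lt_succ_sqrt' (a * c)
    have h3 := Nat.lt_succ_sqrt' (a * b)
    calc (a * (b * c)) ^ 2 = (b * c) * ((a * c) * (a * b)) := by ring
      _ < ((b * c).sqrt + 1) ^ 2 * (((a * c).sqrt + 1) ^ 2 * ((a * b).sqrt + 1) ^ 2) := by
        gcongr
      _ = _ := by ring
  obtain ⟨⟨x, z, w⟩, hs, ⟨x', z', w'⟩, hs', hne, hf⟩ :=
    Finset.exists_ne_map_eq_of_card_lt_of_maps_to hcard (f := f) 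
      (fun _ _ => Finset.mem_coe.2 (Finset.mem_univ _))
  simp only [S, Finset.mem_product, Finset.mem_range, Nat.lt_succ_iff] at hs hs'
  simp only [f, Prod.mk.injEq] at hf
  obtain ⟨f1, f2, f3⟩ := hf
  obtain ⟨X, hX⟩ : ∃ X : ℤ, X = x - x' := ⟨_, rfl⟩
  obtain ⟨Z, hZ⟩ : ∃ Z : ℤ, Z = z - z' := ⟨_, rfl⟩
  obtain ⟨W, hW⟩ : ∃ W : ℤ, W = w - w' := ⟨_, rfl⟩
  have bound : ∀ k s t : ℕ, s ≤ k.sqrt → t ≤ k.sqrt → ((s : ℤ) - t) ^ 2 ≤ k := by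
    intro k s t hs ht
    have h1 : ((k.sqrt : ℤ)) ^ 2 ≤ k := by exact_mod_cast Nat.sqrt_le' k
    have h2 : |(s : ℤ) - t| ≤ k.sqrt := by rw [abs_le]; omega
    calc ((s : ℤ) - t) ^ 2 = |(s : ℤ) - t| ^ 2 := (sq_abs _).symm
      _ ≤ (k.sqrt : ℤ) ^ 2 := by gcongr
      _ ≤ k := h1
  have strict : ∀ (k : ℕ) (Y : ℤ), ¬ IsSquare k → Y ^ 2 ≤ k → Y ^ 2 < k := by
    intro k Y hk hY
    refine lt_of_le_of_ne hY fun e => hk ⟨Y.natAbs, ?_⟩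
    zify
    rw [← sq, sq_abs, e]
  have bX := strict _ _ nsq_bc (hX ▸ bound _ _ _ hs.1 hs'.1)
  have bZ := strict _ _ nsq_ac (hZ ▸ bound _ _ _ hs.2.1 hs'.2.1)
  have bW := hW ▸ bound _ _ _ hs.2.2 hs'.2.2
  push_cast at bX bZ bW
  have d1 : (a : ℤ) ∣ Z - α * W := by
    rw [← ZMod.intCast_zmod_eq_zero_iff_dvd, hZ, hW]
    push_cast
    linear_combination f1
  have d2 : (b : ℤ) ∣ X - β * W := by
    rw [← ZMod.intCast_zmod_eq_zero_iff_dvd, hX, hW]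
    push_cast
    linear_combination f2
  have d3 : (c : ℤ) ∣ Z - γ * X := by
    rw [← ZMod.intCast_zmod_eq_zero_iff_dvd, hX, hZ]
    push_cast
    linear_combination f3
  have hnz : X ≠ 0 ∨ Z ≠ 0 ∨ W ≠ 0 := by
    by_contra! h
    apply hne
    simp only [Prod.mk.injEq]
    omega
  have ha' : (0 : ℤ) < a := by exact_mod_cast ha
  have hb' : (0 : ℤ) < b := by exact_mod_cast hb
  have hc' : (0 : ℤ) < c := by exact_mod_cast hc
  have hdvd : (a * b * c : ℤ) ∣ a * X ^ 2 - b * Z ^ 2 - c * W ^ 2 := by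
    refine IsCoprime.mul_dvd ?_ (IsCoprime.mul_dvd (Nat.isCoprime_iff_coprime.2 hab) ?_ ?_) ?_
    · exact IsCoprime.mul_left (Nat.isCoprime_iff_coprime.2 hac) (Nat.isCoprime_iff_coprime.2 hbc)
    · obtain ⟨k, hk⟩ := d1
      obtain ⟨l, hl⟩ := hα
      exact ⟨X ^ 2 - b * k * (Z + α * W) - W ^ 2 * l,
        by linear_combination -b * (Z + α * W) * hk - W ^ 2 * hl⟩
    · obtain ⟨k, hk⟩ := d2
      obtain ⟨l, hl⟩ := hβ
      exact ⟨a * k * (X + β * W) + W ^ 2 * l - Z ^ 2,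
        by linear_combination a * (X + β * W) * hk + W ^ 2 * hl⟩
    · obtain ⟨k, hk⟩ := d3
      obtain ⟨l, hl⟩ := hγ
      exact ⟨- b * k * (Z + γ * X) - X ^ 2 * l - W ^ 2,
        by linear_combination -b * (Z + γ * X) * hk - X ^ 2 * hl⟩
  exact conic_of_small ha' hb' hc' bX bZ bW hnz hdvd

lemma exists_prime_dvd_add_five (K e : ℕ) (hK : 0 < K) (hK5 : K.Coprime 5) (he : e.Coprime 5)
    (B : ℕ) : ∃ q > B, q.Prime ∧ 8 * K ∣ q + 5 ∧ q ≡ e [MOD 5] := by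
  have h85 : (8 * K).Coprime 5 := Nat.Coprime.mul_left (by norm_num) hK5
  obtain ⟨r, hr1, hr2⟩ := Nat.chineseRemainder h85 (5 * (8 * K - 1)) e
  have c1 : r.Coprime (8 * K) := by
    rw [Nat.Coprime, hr1.gcd_eq]
    refine Nat.Coprime.mul_left h85.symm ?_
    rw [Nat.coprime_comm]
    exact (Nat.coprime_self_sub_right (by omega)).2 (Nat.coprime_one_right _)
  have c2 : r.Coprime 5 := by
    rw [Nat.Coprime, hr2.gcd_eq]
    exact he
  obtain ⟨q, hB, hq, hqr⟩ := Nat.forall_exists_prime_gt_and_modEq B (q := 8 * K * 5) (a := r)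
    (by omega) (Nat.Coprime.mul_right c1 c2)
  refine ⟨q, hB, hq, ?_, (hqr.of_mul_left _).trans hr2⟩
  have h1 : q + 5 ≡ 5 * (8 * K - 1) + 5 [MOD 8 * K] :=
    ((hqr.of_mul_right _).trans hr1).add_right 5
  rw [show 5 * (8 * K - 1) + 5 = 8 * K * 5 by omega] at h1
  exact (Nat.modEq_zero_iff_dvd.1 (h1.trans (Nat.modEq_zero_iff_dvd.2 (dvd_mul_right _ _))))

lemma jacobiSym_eq_of_dvd_add_five {n q : ℕ} (hn : 0 < n) (h : 8 * n ∣ q + 5) :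
    jacobiSym n q = jacobiSym n 5 := by
  obtain ⟨e, m, hm, rfl⟩ := Nat.exists_eq_two_pow_mul_odd hn.ne'
  have hq8 : q % 8 = 3 := by
    have := (dvd_mul_right 8 _).trans h
    omega
  have hqodd : Odd q := Nat.odd_iff.2 (by omega)
  have h2q : jacobiSym 2 q = -1 := by
    rw [jacobiSym.at_two hqodd, ZMod.χ₈_nat_mod_eight, hq8]
    decide
  have h25 : jacobiSym 2 5 = -1 := by
    rw [jacobiSym.at_two (by decide)]
    decide
  have hmq : jacobiSym (q : ℤ) m = jacobiSym (-1) m * jacobiSym (m : ℤ) 5 := by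
    have h5 : jacobiSym ((5 : ℕ) : ℤ) m = jacobiSym (m : ℤ) 5 :=
      jacobiSym.quadratic_reciprocity_one_mod_four (by norm_num) hm
    rw [← h5, ← jacobiSym.mul_left]
    apply jacobiSym.mod_left'
    apply Int.ModEq.symm
    apply (Int.modEq_iff_dvd).2
    have : ((m : ℕ) : ℤ) ∣ ((q + 5 : ℕ) : ℤ) :=
      Int.natCast_dvd_natCast.2 (((dvd_mul_left m (2 ^ e)).mul_left 8).trans h)
    simpa using this
  have key : jacobiSym (m : ℤ) q = jacobiSym (m : ℤ) 5 := by
    rw [jacobiSym.at_neg_one hm] at hmq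
    have hm2 := Nat.odd_iff.1 hm
    obtain h4 | h4 : m % 4 = 1 ∨ m % 4 = 3 := by omega
    · rw [jacobiSym.quadratic_reciprocity_one_mod_four h4 hqodd, hmq, ZMod.χ₄_nat_one_mod_four h4,
        one_mul]
    · rw [jacobiSym.quadratic_reciprocity_three_mod_four h4 (by omega), hmq,
        ZMod.χ₄_nat_three_mod_four h4]
      ring
  push_cast
  rw [jacobiSym.mul_left, jacobiSym.mul_left, jacobiSym.pow_left, jacobiSym.pow_left, key, h2q, h25]

lemma exists_sq_sub_of_jacobiSym {q : ℕ} (hq : q.Prime) {k : ℤ} (h : jacobiSym k q = 1) :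
    ∃ s : ℤ, (q : ℤ) ∣ s ^ 2 - k := by
  have : Fact q.Prime := ⟨hq⟩
  rw [← jacobiSym.legendreSym.to_jacobiSym] at h
  have hk : (k : ZMod q) ≠ 0 := fun h0 => by
    rw [(legendreSym.eq_zero_iff q k).2 h0] at h
    exact zero_ne_one h
  obtain ⟨r, hr⟩ := (legendreSym.eq_one_iff q hk).1 h
  refine ⟨r.val, ?_⟩
  rw [← ZMod.intCast_zmod_eq_zero_iff_dvd]
  push_cast
  rw [ZMod.natCast_zmod_val, hr]
  ring

lemma not_isSquare_mul_prime {p k : ℕ} (hp : p.Prime) (hk : ¬ p ∣ k) : ¬ IsSquare (k * p) := by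
  rintro ⟨x, hx⟩
  have h1 : p ∣ x := by
    have : p ∣ x * x := ⟨k, by rw [← hx]; ring⟩
    exact (hp.dvd_mul.1 this).elim id id
  obtain ⟨y, rfl⟩ := h1
  exact hk ⟨y * y, Nat.eq_of_mul_eq_mul_right hp.pos (by rw [hx]; ring)⟩

lemma exists_mul_sq_eq_sq_add_two_mul_sq {q : ℕ} (hq : q.Prime) (h8 : q % 8 = 3) :
    ∃ X Z W : ℤ, X ≠ 0 ∧ q * X ^ 2 = Z ^ 2 + 2 * W ^ 2 := by
  have : Fact q.Prime := ⟨hq⟩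
  have hodd : Odd q := Nat.odd_iff.2 (by omega)
  have hq2 : q.Coprime 2 := Nat.coprime_two_right.2 hodd
  obtain ⟨s, hs⟩ := exists_sq_sub_of_jacobiSym hq (k := -2) (by
    rw [jacobiSym.at_neg_two hodd, ← ZMod.natCast_mod, h8]
    decide)
  obtain ⟨X, Z, W, hX, h⟩ := legendre_conic q 1 2 s 0 1 (Nat.coprime_one_right _) hq2 (by norm_num)
    hq.pos one_pos two_pos (by simpa using hs) (by simp) (by push_cast; omega)
    (not_isSquare_mul_prime Nat.prime_two (by norm_num))
    (not_isSquare_mul_prime Nat.prime_two (by omega))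
  exact ⟨X, Z, W, hX, by simpa using h⟩

lemma exists_rat_of_conic {q n : ℕ} (hq : q.Prime) (h8 : q % 8 = 3)
    (h : ∃ X Z W : ℤ, X ≠ 0 ∧ n * X ^ 2 = 5 * Z ^ 2 + q * W ^ 2) :
    ∃ w x y z : ℤ, w ≠ 0 ∧ x ^ 2 + 2 * y ^ 2 + 5 * z ^ 2 = n * w ^ 2 := by
  obtain ⟨X, Z, W, hX, h⟩ := h
  obtain ⟨X', Z', W', hX', h'⟩ := exists_mul_sq_eq_sq_add_two_mul_sq hq h8
  exact ⟨X * X', W * Z', W * W', Z * X', mul_ne_zero hX hX',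
    by linear_combination -X' ^ 2 * h - W ^ 2 * h'⟩

lemma coprime_prime_of_lt {n q : ℕ} (hn : 0 < n) (hq : q.Prime) (h : n < q) : n.Coprime q :=
  (Nat.coprime_of_lt_prime hn.ne' h hq).symm

/-- Integers prime to `5` are rationally represented. -/
lemma exists_rat_of_coprime_five {n : ℕ} (hn : 0 < n) (h5 : n.Coprime 5) :
    ∃ w x y z : ℤ, w ≠ 0 ∧ x ^ 2 + 2 * y ^ 2 + 5 * z ^ 2 = n * w ^ 2 := by
  obtain ⟨q, hqB, hq, hdvd, hq5⟩ := exists_prime_dvd_add_five n n hn h5 h5 (n + 5)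
  have hq8 : q % 8 = 3 := by
    have := (dvd_mul_right 8 n).trans hdvd
    omega
  have hnq := coprime_prime_of_lt hn hq (by omega)
  have h5q := coprime_prime_of_lt (n := 5) (by norm_num) hq (by omega)
  apply exists_rat_of_conic hq hq8
  have hj : jacobiSym (5 * n) q = 1 := by
    have e5 : jacobiSym ((5 : ℕ) : ℤ) q = jacobiSym (n : ℤ) 5 := by
      rw [jacobiSym.quadratic_reciprocity_one_mod_four (by norm_num) (Nat.odd_iff.2 (by omega))]
      apply jacobiSym.mod_left'
      exact_mod_cast hq5
    push_cast at e5
    rw [jacobiSym.mul_left, jacobiSym_eq_of_dvd_add_five hn hdvd, e5, ← sq]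
    exact jacobiSym.sq_one (Int.gcd_natCast_natCast n 5 ▸ h5)
  obtain ⟨r, hr⟩ := exists_sq_sub_of_jacobiSym hq hj
  obtain ⟨i, j, hij⟩ := Nat.isCoprime_iff_coprime.2 h5q
  have hγ : (q : ℤ) ∣ 5 * (i * r) ^ 2 - n := by
    obtain ⟨l, hl⟩ := hr
    push_cast at hij
    refine ⟨5 * i ^ 2 * l - n * j * (1 + 5 * i), ?_⟩
    linear_combination 5 * i ^ 2 * hl + n * (1 + 5 * i) * hij
  have hα : (n : ℤ) ∣ 5 * 1 ^ 2 + q := by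
    have : n ∣ 5 + q := by rw [add_comm]; exact (dvd_mul_left n 8).trans hdvd
    simpa using (Int.natCast_dvd_natCast.2 this)
  have hβ : (5 : ℤ) ∣ n * 1 ^ 2 - q := by
    have := (Nat.modEq_iff_dvd.1 hq5)
    simpa using this
  exact legendre_conic n 5 q 1 1 (i * r) h5 hnq h5q hn (by norm_num) hq.pos hα hβ hγ
    (not_isSquare_mul_prime hq (Nat.Prime.coprime_iff_not_dvd hq |>.1 h5q.symm))
    (not_isSquare_mul_prime hq (Nat.Prime.coprime_iff_not_dvd hq |>.1 hnq.symm))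

/-- Five times a square modulo `5` is rationally represented. -/
lemma exists_rat_of_five_mul {n : ℕ} (h5 : n % 5 = 1 ∨ n % 5 = 4) :
    ∃ w x y z : ℤ, w ≠ 0 ∧ x ^ 2 + 2 * y ^ 2 + 5 * z ^ 2 = (5 * n : ℕ) * w ^ 2 := by
  have hn : 0 < n := by omega
  have hn5 : n.Coprime 5 := by
    rw [Nat.coprime_comm, Nat.Prime.coprime_iff_not_dvd Nat.prime_five]
    omega
  obtain ⟨q, hqB, hq, hdvd, -⟩ := exists_prime_dvd_add_five n 1 hn hn5 (by norm_num) (n + 5)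
  have hq8 : q % 8 = 3 := by
    have := (dvd_mul_right 8 n).trans hdvd
    omega
  have hnq := coprime_prime_of_lt hn hq (by omega)
  have h5q := coprime_prime_of_lt (n := 5) (by norm_num) hq (by omega)
  apply exists_rat_of_conic hq hq8
  obtain ⟨t, ht⟩ : ∃ t : ℤ, (5 : ℤ) ∣ t ^ 2 - n := by
    rcases h5 with h | h
    · exact ⟨1, by omega⟩
    · exact ⟨2, by omega⟩
  have hj : jacobiSym n q = 1 := by
    rw [jacobiSym_eq_of_dvd_add_five hn hdvd, jacobiSym.mod_left]
    rcases h5 with h | h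
    · rw [show (n : ℤ) % (5 : ℕ) = 1 by omega]; exact jacobiSym.one_left 5
    · rw [show (n : ℤ) % (5 : ℕ) = 2 ^ 2 by omega]; exact jacobiSym.sq_one' (by norm_num)
  obtain ⟨r, hr⟩ := exists_sq_sub_of_jacobiSym hq hj
  obtain ⟨i, j, hij⟩ := Nat.isCoprime_iff_coprime.2 h5q
  push_cast at hij
  have hγ : ((5 * q : ℕ) : ℤ) ∣ (1 : ℕ) * (t + 5 * i * (r - t)) ^ 2 - n := by
    push_cast
    refine IsCoprime.mul_dvd (by simpa using Nat.isCoprime_iff_coprime.2 h5q) ?_ ?_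
    · obtain ⟨l, hl⟩ := ht
      exact ⟨l + i * (r - t) * (2 * t + 5 * i * (r - t)), by linear_combination hl⟩
    · obtain ⟨l, hl⟩ := hr
      refine ⟨l - j * (r - t) * (2 * r - j * q * (r - t)), ?_⟩
      have e : t + 5 * i * (r - t) = r - j * q * (r - t) := by linear_combination (r - t) * hij
      rw [e]
      linear_combination hl
  have hα : (n : ℤ) ∣ (1 : ℕ) * 5 ^ 2 + (5 * q : ℕ) := by
    have : n ∣ 5 * (q + 5) := ((dvd_mul_left n 8).trans hdvd).mul_left 5
    have := Int.natCast_dvd_natCast.2 this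
    push_cast at this ⊢
    convert this using 1
    ring
  have sq5 : ∀ k : ℕ, k.Coprime q → ¬ IsSquare (k * (5 * q)) := by
    intro k hk
    rw [← mul_assoc]
    exact not_isSquare_mul_prime hq
      (Nat.Prime.coprime_iff_not_dvd hq |>.1 (Nat.Coprime.mul_left hk h5q).symm)
  obtain ⟨X, Z, W, hX, h⟩ := legendre_conic n 1 (5 * q) 5 0 _ (Nat.coprime_one_right _)
    (Nat.Coprime.mul_right hn5 hnq) (Nat.coprime_one_left _) hn one_pos
    (Nat.mul_pos (by norm_num) hq.pos) hα (by simp) hγ (sq5 1 (Nat.coprime_one_left _)) (sq5 n hnq)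
  refine ⟨X, Z, 5 * W, hX, ?_⟩
  push_cast at h ⊢
  linear_combination 5 * h

lemma exists_rat (n : ℕ) (hn : 0 < n)
    (hform : ¬ ∃ s m : ℕ, (m % 5 = 2 ∨ m % 5 = 3) ∧ n = 5 ^ (2 * s + 1) * m) :
    ∃ w x y z : ℤ, w ≠ 0 ∧ x ^ 2 + 2 * y ^ 2 + 5 * z ^ 2 = n * w ^ 2 := by
  obtain ⟨e, n', hn', rfl⟩ := Nat.exists_eq_pow_mul_and_not_dvd hn.ne' 25 (by norm_num)
  have hpos : 0 < n' := Nat.pos_of_ne_zero (by rintro rfl; simp at hn')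
  suffices ∃ w x y z : ℤ, w ≠ 0 ∧ x ^ 2 + 2 * y ^ 2 + 5 * z ^ 2 = n' * w ^ 2 by
    obtain ⟨w, x, y, z, hw, h⟩ := this
    refine ⟨w, 5 ^ e * x, 5 ^ e * y, 5 ^ e * z, hw, ?_⟩
    push_cast
    rw [show (25 : ℤ) = 5 ^ 2 by norm_num, ← pow_mul, mul_comm 2 e, pow_mul]
    linear_combination (5 ^ e) ^ 2 * h
  by_cases h5 : 5 ∣ n'
  · obtain ⟨m, rfl⟩ := h5
    apply exists_rat_of_five_mul
    have : ¬ (m % 5 = 2 ∨ m % 5 = 3) := fun h => hform ⟨e, m, h, by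
      rw [pow_succ, pow_mul]; norm_num; ring⟩
    omega
  · exact exists_rat_of_coprime_five hpos
      ((Nat.Prime.coprime_iff_not_dvd Nat.prime_five).2 h5).symm

theorem stmt_5 (n : ℕ) (hn : 0 < n)
    (hform : ¬ ∃ s m : ℕ, (m % 5 = 2 ∨ m % 5 = 3) ∧ n = 5 ^ (2 * s + 1) * m)
    (h8 : n % 8 = 0) :
    ∃ a₁ a₂ a₃ : ℤ, a₁ ^ 2 + 2 * a₂ ^ 2 + 5 * a₃ ^ 2 = (n : ℤ) ∧
      Odd a₁ ∧ Odd a₂ ∧ Odd a₃ := by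
  induction n using Nat.strong_induction_on with
  | _ n ih =>
    obtain ⟨m, rfl⟩ : ∃ m, n = 4 * m := ⟨n / 4, by omega⟩
    have hodd : m % 8 = 0 →
        ∃ a b c : ℤ, a ^ 2 + 2 * b ^ 2 + 5 * c ^ 2 = (m : ℤ) ∧ Odd a ∧ Odd b ∧ Odd c := by
      refine ih m (by omega) (by omega) ?_
      rintro ⟨s, k, hk, rfl⟩
      exact hform ⟨s, 4 * k, by omega, by ring⟩
    by_cases hm : m % 8 = 0
    · obtain ⟨A, B, C, h, hA, -, -⟩ := hodd hm
      simpa using exists_odd_of_quarter m A B C h (by omega) (fun _ => hA)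
    · obtain ⟨w, x, y, z, hw, h⟩ := exists_rat _ hn hform
      obtain ⟨a, b, c, habc⟩ := exists_int_of_exists_rat m w x y z hw (by simpa using h)
      rcases parity_of_eight_dvd _ a b c habc (by omega) with hall | ⟨A, B, C, hABC⟩
      · exact ⟨a, b, c, by simpa using habc, hall⟩
      · rw [Int.mul_ediv_cancel_left _ (by norm_num)] at hABC
        simpa using exists_odd_of_quarter m A B C hABC (by omega) (fun h => by omega)
end

section
/- Let n be a positive integer not of the form 5^(2s+1)·(5t±2) for nonnegative integers s, t. If n ≡ 6 (mod 8), then there exist integers b₁, b₂, b₃ with b₁² + 2b₂² + 5b₃² = n, b₁ odd, b₂ even, and b₃ odd. -/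
/-- `V` is the set of integers represented by the positive definite ternary form
`a x² + 2b xy + c y² + 2d xz + 2e yz + f z²` of determinant `20`. -/
def RepresentsExactly (V : Set ℤ) (a b c d e f : ℤ) : Prop :=
  0 < a ∧ 0 < a * c - b ^ 2 ∧
    a * c * f + 2 * b * d * e - a * e ^ 2 - c * d ^ 2 - f * b ^ 2 = 20 ∧
    ∀ n, n ∈ V ↔ ∃ x y z : ℤ,
      n = a * x ^ 2 + 2 * b * x * y + c * y ^ 2 + 2 * d * x * z + 2 * e * y * z + f * z ^ 2

namespace RepresentsExactly

variable {V : Set ℤ} {a b c d e f : ℤ}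

theorem shear_xy (h : RepresentsExactly V a b c d e f) (k : ℤ) :
    RepresentsExactly V a (b + k * a) (c + 2 * k * b + k ^ 2 * a) d (e + k * d) f := by
  obtain ⟨h1, h2, h3, h4⟩ := h
  refine ⟨h1, by linear_combination h2, by linear_combination h3, fun n => (h4 n).trans ?_⟩
  constructor
  · rintro ⟨x, y, z, rfl⟩
    exact ⟨x - k * y, y, z, by ring⟩
  · rintro ⟨x, y, z, rfl⟩
    exact ⟨x + k * y, y, z, by ring⟩

theorem shear_xz (h : RepresentsExactly V a b c d e f) (k : ℤ) :
    RepresentsExactly V a b c (d + k * a) (e + k * b) (f + 2 * k * d + k ^ 2 * a) := by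
  obtain ⟨h1, h2, h3, h4⟩ := h
  refine ⟨h1, h2, by linear_combination h3, fun n => (h4 n).trans ?_⟩
  constructor
  · rintro ⟨x, y, z, rfl⟩
    exact ⟨x - k * z, y, z, by ring⟩
  · rintro ⟨x, y, z, rfl⟩
    exact ⟨x + k * z, y, z, by ring⟩

theorem shear_yz (h : RepresentsExactly V a b c d e f) (k : ℤ) :
    RepresentsExactly V a b c (d + k * b) (e + k * c) (f + 2 * k * e + k ^ 2 * c) := by
  obtain ⟨h1, h2, h3, h4⟩ := h
  refine ⟨h1, h2, by linear_combination h3, fun n => (h4 n).trans ?_⟩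
  constructor
  · rintro ⟨x, y, z, rfl⟩
    exact ⟨x, y - k * z, z, by ring⟩
  · rintro ⟨x, y, z, rfl⟩
    exact ⟨x, y + k * z, z, by ring⟩

theorem swap_xy (h : RepresentsExactly V a b c d e f) :
    RepresentsExactly V c b a e d f := by
  obtain ⟨h1, h2, h3, h4⟩ := h
  refine ⟨by nlinarith [sq_nonneg b], by linear_combination h2, by linear_combination h3,
    fun n => (h4 n).trans ?_⟩
  constructor
  · rintro ⟨x, y, z, rfl⟩
    exact ⟨y, x, z, by ring⟩
  · rintro ⟨x, y, z, rfl⟩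
    exact ⟨y, x, z, by ring⟩

theorem minor_mul_minor (h : RepresentsExactly V a b c d e f) :
    (a * c - b ^ 2) * (a * f - d ^ 2) = 20 * a + (a * e - b * d) ^ 2 := by
  linear_combination a * h.2.2.1

theorem swap_yz (h : RepresentsExactly V a b c d e f) :
    RepresentsExactly V a d f b e c := by
  have h0 := h.minor_mul_minor
  obtain ⟨h1, h2, h3, h4⟩ := h
  refine ⟨h1, ?_, by linear_combination h3, fun n => (h4 n).trans ?_⟩
  · exact pos_of_mul_pos_right (a := a * c - b ^ 2) (by rw [h0]; positivity) h2.le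
  constructor
  · rintro ⟨x, y, z, rfl⟩
    exact ⟨x, z, y, by ring⟩
  · rintro ⟨x, y, z, rfl⟩
    exact ⟨x, z, y, by ring⟩

end RepresentsExactly

theorem exists_abs_two_mul_add_mul_le (b : ℤ) {a : ℤ} (ha : 0 < a) :
    ∃ k : ℤ, |2 * (b + k * a)| ≤ a := by
  refine ⟨-((2 * b + a) / (2 * a)), ?_⟩
  have h1 := Int.emod_add_mul_ediv (2 * b + a) (2 * a)
  have h2 := Int.emod_nonneg (2 * b + a) (show 2 * a ≠ 0 by lia)
  have h3 := Int.emod_lt_of_pos (2 * b + a) (show 0 < 2 * a by lia)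
  rw [abs_le]
  constructor <;> nlinarith

theorem RepresentsExactly.exists_reduced {V : Set ℤ} {a b c d e f : ℤ}
    (h : RepresentsExactly V a b c d e f) :
    ∃ a b c d e f : ℤ, RepresentsExactly V a b c d e f ∧
      3 * a ^ 2 ≤ 4 * (a * c - b ^ 2) ∧ 3 * (a * c - b ^ 2) ^ 2 ≤ 80 * a ∧
      |2 * b| ≤ a ∧ |2 * d| ≤ a ∧ |2 * (a * e - b * d)| ≤ a * c - b ^ 2 := by
  classical
  have hex : ∃ N : ℕ, ∃ a b c d e f : ℤ, RepresentsExactly V a b c d e f ∧ a = N :=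
    ⟨a.toNat, a, b, c, d, e, f, h, (Int.toNat_of_nonneg h.1.le).symm⟩
  obtain ⟨a₁, b₁, c₁, d₁, e₁, f₁, h₁, ha₁⟩ := Nat.find_spec hex
  have hmin {a b c d e f : ℤ} (h : RepresentsExactly V a b c d e f) : a₁ ≤ a := by
    have := Nat.find_min' hex ⟨a, b, c, d, e, f, h, (Int.toNat_of_nonneg h.1.le).symm⟩
    have := h.1
    lia
  have hex' : ∃ N : ℕ, ∃ b c d e f : ℤ, RepresentsExactly V a₁ b c d e f ∧
      a₁ * c - b ^ 2 = N :=
    ⟨_, b₁, c₁, d₁, e₁, f₁, h₁, (Int.toNat_of_nonneg h₁.2.1.le).symm⟩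
  obtain ⟨b₂, c₂, d₂, e₂, f₂, h₂, hA₂⟩ := Nat.find_spec hex'
  have hmin' {b c d e f : ℤ} (h : RepresentsExactly V a₁ b c d e f) :
      a₁ * c₂ - b₂ ^ 2 ≤ a₁ * c - b ^ 2 := by
    have := Nat.find_min' hex' ⟨b, c, d, e, f, h, (Int.toNat_of_nonneg h.2.1.le).symm⟩
    have := h.2.1
    lia
  obtain ⟨k, hk⟩ := exists_abs_two_mul_add_mul_le (a₁ * e₂ - b₂ * d₂) h₂.2.1
  have h₃ := h₂.shear_yz k
  obtain ⟨l, hl⟩ := exists_abs_two_mul_add_mul_le b₂ h₂.1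
  have h₄ := h₃.shear_xy l
  obtain ⟨j, hj⟩ := exists_abs_two_mul_add_mul_le (d₂ + k * b₂) h₂.1
  have h₅ := h₄.shear_xz j
  refine ⟨_, _, _, _, _, _, h₅, ?_, ?_, hl, hj, ?_⟩
  · have := hmin h₅.swap_xy
    have hsq := sq_le_sq.mpr (hl.trans (le_abs_self a₁))
    nlinarith [h₅.1]
  · have h6 := hmin' h₃.swap_yz
    have h7 := h₃.minor_mul_minor
    have hsq := sq_le_sq.mpr (hk.trans (le_abs_self _))
    have hpos := h₂.2.1
    have e1 : a₁ * (c₂ + 2 * l * b₂ + l ^ 2 * a₁) - (b₂ + l * a₁) ^ 2 = a₁ * c₂ - b₂ ^ 2 := by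
      ring
    have e2 : a₁ * (e₂ + k * c₂) - b₂ * (d₂ + k * b₂) =
      a₁ * e₂ - b₂ * d₂ + k * (a₁ * c₂ - b₂ ^ 2) := by ring
    rw [e1]
    rw [e2] at h7
    nlinarith
  · convert hk using 1
    · congr 1
      ring
    · ring

/-- The reduced positive definite ternary forms of determinant `20` that represent some odd integer
and take no value `≡ 1 mod 4` at vectors with coordinates in `{0, 1}`. -/
theorem reduced_coeffs_cases {a b c d e f : ℤ} (ha0 : 0 < a) (hA0 : 0 < a * c - b ^ 2)
    (ha : 3 * a ^ 2 ≤ 4 * (a * c - b ^ 2)) (hA : 3 * (a * c - b ^ 2) ^ 2 ≤ 80 * a)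
    (hb : |2 * b| ≤ a) (hd : |2 * d| ≤ a) (hB : |2 * (a * e - b * d)| ≤ a * c - b ^ 2)
    (h20 : (a * c - b ^ 2) * (a * f - d ^ 2) = 20 * a + (a * e - b * d) ^ 2)
    (v1 : a % 4 ≠ 1) (v2 : c % 4 ≠ 1) (v4 : (a + 2 * b + c) % 4 ≠ 1)
    (v5 : (a + 2 * d + f) % 4 ≠ 1) (v6 : (c + 2 * e + f) % 4 ≠ 1)
    (v7 : (a + 2 * b + c + 2 * d + 2 * e + f) % 4 ≠ 1)
    (hodd : ¬ (a % 2 = 0 ∧ c % 2 = 0 ∧ f % 2 = 0)) :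
    (a = 2 ∧ c = 3 ∧ f = 4 ∧ d = 0 ∧ e = 0 ∧ (b = 1 ∨ b = -1)) ∨
      (a = 3 ∧ c = 3 ∧ f = 3 ∧ b % 2 = 1 ∧ d % 2 = 1 ∧ e % 2 = 1) := by
  have ha3 : a ≤ 3 := by
    generalize a * c - b ^ 2 = A at *
    by_contra! h4
    have h5 : 3 * a ≤ A := by nlinarith
    have h6 : A ≤ 8 := by nlinarith
    lia
  have hA8 : a * c - b ^ 2 ≤ 8 := by
    generalize a * c - b ^ 2 = A at *
    nlinarith
  rw [abs_le] at hb hd hB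
  have hb1 : b ≤ 1 := by lia
  have hb2 : -1 ≤ b := by lia
  have hd1 : d ≤ 1 := by lia
  have hd2 : -1 ≤ d := by lia
  have ha2 : 2 ≤ a := by lia
  have hc : 2 ≤ c ∧ c ≤ 4 := by
    clear v1 v4 v5 v6 v7 hodd h20 hB
    interval_cases a <;> interval_cases b <;> omega
  obtain ⟨hc1, hc2⟩ := hc
  have he : -2 ≤ e ∧ e ≤ 2 := by
    clear v1 v2 v4 v5 v6 v7 hodd h20 hA
    interval_cases a <;> interval_cases b <;> interval_cases d <;> omega
  obtain ⟨he1, he2⟩ := he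
  interval_cases a <;> interval_cases b <;> interval_cases c <;>
    first
    | (exfalso; clear v1 v2 v4 v5 v6 v7 hodd h20 hB; omega)
    | skip
  all_goals interval_cases d <;> interval_cases e <;>
    first
    | (exfalso; clear v1 v2 v4 v5 v6 v7 hodd; omega)
    | omega

/-- A ternary form of determinant `20` which represents no integer `≡ 1 mod 4` but integers
`≡ 2` and `≡ 3 mod 4` is equivalent to `2x² + 2xy + 3y² + 4z²`. -/
theorem RepresentsExactly.exists_eq_of_mem {V : Set ℤ} {a b c d e f : ℤ}
    (h : RepresentsExactly V a b c d e f) (h1 : ∀ n ∈ V, n % 4 ≠ 1)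
    (h2 : ∃ n ∈ V, n % 4 = 2) {m : ℤ} (hm : m ∈ V) (hm3 : m % 4 = 3) :
    ∃ x y z : ℤ, m = 2 * x ^ 2 + 2 * x * y + 3 * y ^ 2 + 4 * z ^ 2 := by
  obtain ⟨a, b, c, d, e, f, h, ha, hA, hb, hd, hB⟩ := h.exists_reduced
  have h20 := h.minor_mul_minor
  obtain ⟨ha0, hA0, hdet, hV⟩ := h
  have hval (x y z : ℤ) := h1 _ ((hV _).mpr ⟨x, y, z, rfl⟩)
  have v1 : a % 4 ≠ 1 := by simpa using hval 1 0 0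
  have v2 : c % 4 ≠ 1 := by simpa using hval 0 1 0
  have v4 : (a + 2 * b + c) % 4 ≠ 1 := by simpa using hval 1 1 0
  have v5 : (a + 2 * d + f) % 4 ≠ 1 := by simpa using hval 1 0 1
  have v6 : (c + 2 * e + f) % 4 ≠ 1 := by simpa using hval 0 1 1
  have v7 : (a + 2 * b + c + 2 * d + 2 * e + f) % 4 ≠ 1 := by simpa using hval 1 1 1
  have hodd : ¬ (a % 2 = 0 ∧ c % 2 = 0 ∧ f % 2 = 0) := by
    rintro ⟨pa, pc, pf⟩
    obtain ⟨x, y, z, rfl⟩ := (hV m).mp hm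
    obtain ⟨a', rfl⟩ := Int.dvd_of_emod_eq_zero pa
    obtain ⟨c', rfl⟩ := Int.dvd_of_emod_eq_zero pc
    obtain ⟨f', rfl⟩ := Int.dvd_of_emod_eq_zero pf
    have : 2 * a' * x ^ 2 + 2 * b * x * y + 2 * c' * y ^ 2 + 2 * d * x * z + 2 * e * y * z +
      2 * f' * z ^ 2 = 2 * (a' * x ^ 2 + b * x * y + c' * y ^ 2 + d * x * z + e * y * z +
      f' * z ^ 2) := by ring
    lia
  rcases reduced_coeffs_cases ha0 hA0 ha hA hb hd hB h20 v1 v2 v4 v5 v6 v7 hodd with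
    ⟨rfl, rfl, rfl, rfl, rfl, rfl | rfl⟩ | ⟨rfl, rfl, rfl, hb', hd', he'⟩
  · obtain ⟨x, y, z, h⟩ := (hV m).mp hm
    exact ⟨x, y, z, by linear_combination h⟩
  · obtain ⟨x, y, z, h⟩ := (hV m).mp hm
    exact ⟨-x, y, z, by linear_combination h⟩
  · obtain ⟨b', rfl⟩ : ∃ b', b = 2 * b' - 1 := ⟨(b + 1) / 2, by lia⟩
    obtain ⟨d', rfl⟩ : ∃ d', d = 2 * d' - 1 := ⟨(d + 1) / 2, by lia⟩
    obtain ⟨e', rfl⟩ : ∃ e', e = 2 * e' - 1 := ⟨(e + 1) / 2, by lia⟩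
    obtain ⟨n, hn, hn2⟩ := h2
    obtain ⟨x, y, z, h⟩ := (hV n).mp hn
    have h' : n = 4 * (x ^ 2 + y ^ 2 + z ^ 2 + b' * x * y + d' * x * z + e' * y * z) -
      (x + y + z) ^ 2 := by linear_combination h
    rcases Int.even_or_odd' (x + y + z) with ⟨t, ht | ht⟩
    · have : (x + y + z) ^ 2 = 4 * t ^ 2 := by rw [ht]; ring
      lia
    · have : (x + y + z) ^ 2 = 4 * (t ^ 2 + t) + 1 := by rw [ht]; ring
      lia

open NumberTheorySymbols in
/-- The form used here is `a x² + 2b xy + p y² + 2s xz + m z²` with `a p = b ^ 2 + k`. -/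
theorem exists_eq_of_prime {m s k p : ℕ} (hp : p.Prime) (hp4 : p % 4 = 3) (hk4 : k % 4 = 1)
    (hm4 : m % 4 = 3) (hs : Odd s) (hdet : m * k = s ^ 2 * p + 20) (hJ : J(p | k) = -1) :
    ∃ x y z : ℤ, (m : ℤ) = 2 * x ^ 2 + 2 * x * y + 3 * y ^ 2 + 4 * z ^ 2 := by
  have : Fact p.Prime := ⟨hp⟩
  have hpodd : Odd p := Nat.odd_iff.mpr (by lia)
  have hJ' : J(-k | p) = 1 := by
    rw [jacobiSym.neg _ hpodd, jacobiSym.quadratic_reciprocity_one_mod_four hk4 hpodd, hJ,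
      ZMod.χ₄_nat_three_mod_four hp4]
    norm_num
  obtain ⟨r, hr⟩ := ZMod.isSquare_of_jacobiSym_eq_one hJ'
  obtain ⟨b, hb, hbp⟩ : ∃ b : ℤ, Even b ∧ (p : ℤ) ∣ b ^ 2 + k := by
    have hr' (j : ℤ) : (p : ℤ) ∣ ((r.val : ℤ) + j * p) ^ 2 + k := by
      rw [← ZMod.intCast_zmod_eq_zero_iff_dvd]
      push_cast at hr ⊢
      simp only [ZMod.natCast_val, ZMod.cast_id', id, CharP.cast_eq_zero, mul_zero, add_zero]
      linear_combination -hr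
    rcases Nat.even_or_odd r.val with h | h
    · refine ⟨r.val + 0 * p, ?_, hr' 0⟩
      rw [zero_mul, add_zero]
      exact_mod_cast h
    · refine ⟨r.val + 1 * p, ?_, hr' 1⟩
      rw [one_mul]
      exact_mod_cast h.add_odd hpodd
  obtain ⟨a, ha⟩ := hbp
  obtain ⟨b, rfl⟩ := hb.two_dvd
  obtain ⟨t, rfl⟩ := hs
  have hp0 : (0 : ℤ) < p := by exact_mod_cast hp.pos
  have hk0 : (0 : ℤ) < k := by lia
  have ha0 : 0 < a := by
    refine pos_of_mul_pos_right (a := (p : ℤ)) ?_ hp0.le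
    rw [← ha]
    positivity
  obtain ⟨p', hp'⟩ : ∃ p' : ℤ, (p : ℤ) = 4 * p' - 1 := ⟨(p + 1) / 4, by lia⟩
  obtain ⟨m', hm'⟩ : ∃ m' : ℤ, (m : ℤ) = 4 * m' - 1 := ⟨(m + 1) / 4, by lia⟩
  obtain ⟨a', ha'⟩ : ∃ a' : ℤ, a = 4 * a' - 1 := by
    refine ⟨p' * a - b ^ 2 - (k - 1) / 4, ?_⟩
    rw [hp'] at ha
    have : (k : ℤ) = 4 * ((k - 1) / 4) + 1 := by lia
    linear_combination ha - this
  have hdet' : (m : ℤ) * k = (2 * t + 1) ^ 2 * p + 20 := by exact_mod_cast hdet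
  have hrep : RepresentsExactly {n | ∃ x y z : ℤ, n = a * x ^ 2 + 2 * (2 * b) * x * y + p * y ^ 2 +
      2 * (2 * t + 1) * x * z + 2 * 0 * y * z + m * z ^ 2} a (2 * b) p (2 * t + 1) 0 m :=
    ⟨ha0, by linarith, by linear_combination hdet' - (m : ℤ) * ha, fun n => Iff.rfl⟩
  refine hrep.exists_eq_of_mem ?_ ⟨a + 2 * (2 * b) + p, ⟨1, 1, 0, by ring⟩, by lia⟩
    ⟨0, 0, 1, by ring⟩ (by lia)
  rintro n ⟨x, y, z, rfl⟩
  have : a * x ^ 2 + 2 * (2 * b) * x * y + p * y ^ 2 + 2 * (2 * t + 1) * x * z + 2 * 0 * y * z +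
      m * z ^ 2 = 4 * (a' * x ^ 2 + b * x * y + p' * y ^ 2 + t * x * z + m' * z ^ 2) -
      (x - z) ^ 2 - y ^ 2 := by
    rw [hp', hm', ha']
    ring
  rw [this]
  rcases Int.even_or_odd' (x - z) with ⟨u, hu | hu⟩ <;>
    rcases Int.even_or_odd' y with ⟨v, rfl | rfl⟩ <;> rw [hu] <;> ring_nf <;> lia

open NumberTheorySymbols in
theorem jacobiSym_five_eq_neg_one {k : ℕ} (hk : Odd k) (hk5 : k % 5 = 2 ∨ k % 5 = 3) :
    J((5 : ℕ) | k) = -1 := by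
  rw [jacobiSym.quadratic_reciprocity_one_mod_four (by norm_num) hk, jacobiSym.mod_left]
  have : (k : ℤ) % (5 : ℕ) = 2 ∨ (k : ℤ) % (5 : ℕ) = 3 := by lia
  rcases this with h | h <;> rw [h] <;> norm_num

open NumberTheorySymbols in
theorem exists_eq_of_not_five_dvd {m : ℕ} (hm4 : m % 4 = 3) (hm5 : ¬ 5 ∣ m) :
    ∃ x y z : ℤ, (m : ℤ) = 2 * x ^ 2 + 2 * x * y + 3 * y ^ 2 + 4 * z ^ 2 := by
  have h2 : IsCoprime (m : ℤ) 2 := by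
    rw [Int.isCoprime_iff_gcd_eq_one]
    exact Nat.Coprime.symm ((Nat.Prime.coprime_iff_not_dvd Nat.prime_two).mpr (by lia))
  have h5 : IsCoprime (m : ℤ) 5 := by
    rw [Int.isCoprime_iff_gcd_eq_one]
    exact Nat.Coprime.symm ((Nat.Prime.coprime_iff_not_dvd Nat.prime_five).mpr hm5)
  have h20 : IsCoprime (m : ℤ) 20 := by
    rw [show (20 : ℤ) = 2 * 2 * 5 by norm_num]
    exact (h2.mul_right h2).mul_right h5
  have hcop : IsCoprime (17 * m - 20 : ℤ) ((20 * m : ℕ) : ℤ) := by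
    push_cast
    refine IsCoprime.mul_right ?_ ?_
    · have h17 : IsCoprime (17 * m : ℤ) 20 :=
        IsCoprime.mul_left (by norm_num) h20
      simpa [sub_eq_add_neg] using h17.add_mul_left_left (-1)
    · have := (h20.symm.neg_left).add_mul_right_left 17
      rwa [neg_add_eq_sub] at this
  obtain ⟨p, -, hp, hpm⟩ := Nat.forall_exists_prime_gt_and_zmodEq 0 (by lia) hcop
  obtain ⟨j, hj⟩ := hpm.symm.dvd
  push_cast at hj
  have hmk : (m : ℤ) * (17 + 20 * j) = p + 20 := by linear_combination -hj
  have hk0 : 0 < 17 + 20 * j :=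
    pos_of_mul_pos_right (a := (m : ℤ)) (by rw [hmk]; positivity) (by positivity)
  obtain ⟨k, hk⟩ := Int.eq_ofNat_of_zero_le hk0.le
  rw [hk] at hmk
  have hkodd : Odd k := Nat.odd_iff.mpr (by lia)
  have hp4 : p % 4 = 3 := by
    have : (p : ℤ) = 4 * (4 * m + 5 * (m * j) - 5) + m := by linear_combination hj
    lia
  refine exists_eq_of_prime (s := 1) hp hp4 (k := k) (by lia) hm4 odd_one
    (by rw [one_pow, one_mul]; exact_mod_cast hmk) ?_
  have hmod : J(p | k) = J((-1) * 2 ^ 2 * (5 : ℕ) | k) := by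
    refine jacobiSym.mod_left' (Int.modEq_iff_dvd.mpr ⟨-m, ?_⟩)
    push_cast
    linear_combination hmk
  rw [hmod, jacobiSym.mul_left, jacobiSym.mul_left, show (2 : ℤ) ^ 2 = 4 by norm_num,
    jacobiSym.at_four hkodd, jacobiSym.at_neg_one hkodd, ZMod.χ₄_nat_one_mod_four (by lia),
    jacobiSym_five_eq_neg_one hkodd (by lia)]
  norm_num

open NumberTheorySymbols in
theorem exists_eq_five_mul {l : ℕ} (hl4 : l % 4 = 3) (hl5 : l % 5 = 2 ∨ l % 5 = 3) :
    ∃ x y z : ℤ, ((5 * l : ℕ) : ℤ) = 2 * x ^ 2 + 2 * x * y + 3 * y ^ 2 + 4 * z ^ 2 := by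
  obtain ⟨k₀, r, hr, hk4, hk5⟩ : ∃ k₀ r : ℤ, l * k₀ = 5 * r + 4 ∧ k₀ % 4 = 1 ∧
      (k₀ % 5 = 2 ∨ k₀ % 5 = 3) := by
    rcases hl5 with h | h
    · exact ⟨17, (17 * l - 4) / 5, by lia, by lia, by lia⟩
    · exact ⟨13, (13 * l - 4) / 5, by lia, by lia, by lia⟩
  have hr4 : r % 4 = 3 := by
    have : (l : ℤ) * k₀ = 4 * (l * (k₀ / 4)) + l := by
      have : k₀ = 4 * (k₀ / 4) + 1 := by lia
      linear_combination (l : ℤ) * this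
    lia
  have hr2 : IsCoprime r 2 := by
    rw [Int.isCoprime_two_right]
    exact Int.odd_iff.mpr (by lia)
  have hl2 : IsCoprime (l : ℤ) 2 := by
    rw [Int.isCoprime_two_right]
    exact Int.odd_iff.mpr (by lia)
  have hcop : IsCoprime r ((4 * l : ℕ) : ℤ) := by
    push_cast
    rw [show (4 : ℤ) = 2 * 2 by norm_num]
    refine (hr2.mul_right hr2).mul_right ?_
    have h4 : IsCoprime (2 * 2 : ℤ) l := hl2.symm.mul_left hl2.symm
    have h5 : IsCoprime (r * -5) (l : ℤ) := by
      rw [show r * -5 = 2 * 2 + l * -k₀ by linear_combination hr]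
      exact h4.add_mul_left_left _
    exact h5.of_mul_left_left
  obtain ⟨p, -, hp, hpl⟩ := Nat.forall_exists_prime_gt_and_zmodEq 0 (by lia) hcop
  obtain ⟨j, hj⟩ := hpl.symm.dvd
  push_cast at hj
  have hlk : (l : ℤ) * (k₀ + 20 * j) = 5 * p + 4 := by linear_combination hr - 5 * hj
  have hk0 : 0 < k₀ + 20 * j :=
    pos_of_mul_pos_right (a := (l : ℤ)) (by rw [hlk]; positivity) (by positivity)
  obtain ⟨k, hk⟩ := Int.eq_ofNat_of_zero_le hk0.le
  rw [hk] at hlk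
  have hkodd : Odd k := Nat.odd_iff.mpr (by lia)
  have hp4 : p % 4 = 3 := by
    have : (p : ℤ) = 4 * (l * j) + r := by linear_combination hj
    lia
  have hlk' : l * k = 5 * p + 4 := by exact_mod_cast hlk
  refine exists_eq_of_prime (s := 5) hp hp4 (k := k) (by lia) (by lia) (by decide)
    (by linear_combination 5 * hlk') ?_
  have hmod : J((5 : ℕ) * p | k) = J((-1) * 4 | k) := by
    refine jacobiSym.mod_left' (Int.modEq_iff_dvd.mpr ⟨-l, ?_⟩)
    push_cast
    linear_combination hlk
  rw [jacobiSym.mul_left, jacobiSym.mul_left, jacobiSym_five_eq_neg_one hkodd (by lia),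
    jacobiSym.at_four hkodd, jacobiSym.at_neg_one hkodd, ZMod.χ₄_nat_one_mod_four (by lia)] at hmod
  lia

theorem exists_eq_of_mod_four_eq_three (m : ℕ) (hm4 : m % 4 = 3)
    (hm : ¬ ∃ s l : ℕ, (l % 5 = 1 ∨ l % 5 = 4) ∧ m = 5 ^ (2 * s + 1) * l) :
    ∃ x y z : ℤ, (m : ℤ) = 2 * x ^ 2 + 2 * x * y + 3 * y ^ 2 + 4 * z ^ 2 := by
  induction m using Nat.strong_induction_on with
  | _ m ih =>
    by_cases h5 : 5 ∣ m
    · obtain ⟨l, rfl⟩ := h5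
      by_cases h5' : 5 ∣ l
      · obtain ⟨l, rfl⟩ := h5'
        obtain ⟨x, y, z, h⟩ := ih l (by lia) (by lia) (by
          rintro ⟨s, t, ht, rfl⟩
          exact hm ⟨s + 1, t, ht, by ring⟩)
        exact ⟨5 * x, 5 * y, 5 * z, by push_cast; linear_combination 25 * h⟩
      · have : ¬ (l % 5 = 1 ∨ l % 5 = 4) := fun h => hm ⟨0, l, h, by ring⟩
        exact exists_eq_five_mul (by lia) (by lia)
    · exact exists_eq_of_not_five_dvd hm4 h5

theorem stmt_6 (n : ℕ) (hn : 0 < n)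
    (hform : ¬ ∃ s m : ℕ, (m % 5 = 2 ∨ m % 5 = 3) ∧ n = 5 ^ (2 * s + 1) * m)
    (h8 : n % 8 = 6) :
    ∃ b₁ b₂ b₃ : ℤ, b₁ ^ 2 + 2 * b₂ ^ 2 + 5 * b₃ ^ 2 = (n : ℤ) ∧
      Odd b₁ ∧ Even b₂ ∧ Odd b₃ := by
  obtain ⟨m, rfl⟩ : 2 ∣ n := by lia
  obtain ⟨x, y, z, h⟩ := exists_eq_of_mod_four_eq_three m (by lia) (by
    rintro ⟨s, l, hl, rfl⟩
    exact hform ⟨s, 2 * l, by lia, by ring⟩)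
  have hy : Odd y := by
    by_contra hy
    obtain ⟨w, rfl⟩ := (Int.not_odd_iff_even.mp hy).two_dvd
    have : (m : ℤ) = 2 * (x ^ 2 + x * (2 * w) + 6 * w ^ 2 + 2 * z ^ 2) := by linear_combination h
    lia
  refine ⟨2 * x + y, 2 * z, y, by push_cast; linear_combination -2 * h, ?_, even_two_mul z, hy⟩
  exact (even_two_mul x).add_odd hy
end

section
/- The quaternary quadratic form x² + y² + 2z² + 8w² + 2zw is primitively universal: every positive integer n admits integers x, y, z, w with gcd(x,y,z,w) = 1 and x² + y² + 2z² + 8w² + 2zw = n. -/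
/-- The nearest-multiple form of division with remainder. -/
lemma exists_sub_mul_abs_le (a b : ℤ) (ha : 0 < a) :
    ∃ k : ℤ, -a ≤ 2 * (b - k * a) ∧ 2 * (b - k * a) ≤ a := by
  refine ⟨(2 * b + a) / (2 * a), ?_, ?_⟩
  · have := Int.ediv_mul_le (2 * b + a) (b := 2 * a) (by positivity)
    linarith
  · have := Int.lt_ediv_add_one_mul_self (2 * b + a) (b := 2 * a) (by positivity)
    linarith

/-- Reduction of positive definite binary forms. -/
lemma exists_binary_reduction (A B C : ℤ) (hA : 0 < A) (hD : 0 < A * C - B ^ 2) :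
    ∃ p q r s : ℤ, p * s - q * r = 1 ∧ 0 < A * p ^ 2 + 2 * B * p * r + C * r ^ 2 ∧
      3 * (A * p ^ 2 + 2 * B * p * r + C * r ^ 2) ^ 2 ≤ 4 * (A * C - B ^ 2) := by
  induction hm : A.toNat using Nat.strong_induction_on generalizing A B C with
  | _ m ih =>
  by_cases hred : 3 * A ^ 2 ≤ 4 * (A * C - B ^ 2)
  · exact ⟨1, 0, 0, 1, by norm_num, by simpa using hA, by simpa using hred⟩
  · obtain ⟨k, hk1, hk2⟩ := exists_sub_mul_abs_le A B hA
    set B' := B - k * A with hB'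
    set C' := C - 2 * k * B + k ^ 2 * A with hC'
    have hdisc : A * C' - B' ^ 2 = A * C - B ^ 2 := by rw [hB', hC']; ring
    have hsq : 4 * B' ^ 2 ≤ A ^ 2 := by nlinarith
    have hC'pos : 0 < C' := by
      by_contra! hle
      nlinarith [sq_nonneg B']
    have hlt : C' < A := by
      by_contra! hle
      nlinarith
    obtain ⟨p, q, r, s, hdet, hpos, hle⟩ :=
      ih C'.toNat (by omega) C' (-B') A hC'pos (by linarith) rfl
    have hval : A * (-r - k * p) ^ 2 + 2 * B * (-r - k * p) * p + C * p ^ 2 =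
        C' * p ^ 2 + 2 * -B' * p * r + A * r ^ 2 := by rw [hB', hC']; ring
    refine ⟨-r - k * p, -s - k * q, p, q, by linarith, ?_, ?_⟩
    · rwa [hval]
    · rw [hval]
      linarith

/-- A positive definite binary form of determinant one takes only values that are
sums of two squares. -/
lemma binary_det_one_eq_sum_two_sq (A B C : ℤ) (hA : 0 < A) (hD : A * C - B ^ 2 = 1) (y z : ℤ) :
    ∃ u v : ℤ, A * y ^ 2 + 2 * B * y * z + C * z ^ 2 = u ^ 2 + v ^ 2 := by
  obtain ⟨p, q, r, s, -, hpos, hle⟩ := exists_binary_reduction A B C hA (by omega)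
  have h1 : A * p ^ 2 + 2 * B * p * r + C * r ^ 2 = 1 := by nlinarith
  refine ⟨y * (A * p + B * r) + z * (B * p + C * r), p * z - r * y, ?_⟩
  linear_combination (-(A * y ^ 2 + 2 * B * y * z + C * z ^ 2)) * h1 + (p * z - r * y) ^ 2 * hD

/-- A positive definite ternary form of determinant one takes only values that are
sums of three squares. -/
lemma ternary_det_one_eq_sum_three_sq (a b c f g h : ℤ) (ha : 0 < a) (hab : 0 < a * b - h ^ 2)
    (hdet : a * b * c + 2 * f * g * h - a * f ^ 2 - b * g ^ 2 - c * h ^ 2 = 1) (x y z : ℤ) :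
    ∃ u v w : ℤ, a * x ^ 2 + b * y ^ 2 + c * z ^ 2 + 2 * f * y * z + 2 * g * x * z + 2 * h * x * y =
      u ^ 2 + v ^ 2 + w ^ 2 := by
  induction hm : a.toNat using Nat.strong_induction_on generalizing a b c f g h x y z with
  | _ m ih =>
  by_cases ha1 : a = 1
  · subst ha1
    obtain ⟨v, w, hvw⟩ := binary_det_one_eq_sum_two_sq (b - h ^ 2) (f - g * h) (c - g ^ 2)
      (by linarith) (by linear_combination hdet) y z
    exact ⟨x + h * y + g * z, v, w, by linear_combination hvw⟩
  have hdisc : (a * b - h ^ 2) * (a * c - g ^ 2) - (a * f - g * h) ^ 2 = a := by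
    linear_combination a * hdet
  obtain ⟨p, q, r, s, hps, hpos, hle⟩ := exists_binary_reduction (a * b - h ^ 2) (a * f - g * h)
    (a * c - g ^ 2) hab (by omega)
  rw [hdisc] at hle
  obtain ⟨k, hk1, hk2⟩ := exists_sub_mul_abs_le a (h * p + g * r) ha
  set h' := h * p + g * r - k * a with hh'
  set b' := b * p ^ 2 + 2 * f * p * r + c * r ^ 2 - 2 * k * (h * p + g * r) + k ^ 2 * a with hb'
  set d := (a * b - h ^ 2) * p ^ 2 + 2 * (a * f - g * h) * p * r + (a * c - g ^ 2) * r ^ 2 with hd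
  have hdb : a * b' - h' ^ 2 = d := by rw [hb', hh', hd]; ring
  have hsq : 4 * h' ^ 2 ≤ a ^ 2 := by nlinarith
  have hb'pos : 0 < b' := by
    by_contra! hneg
    nlinarith [sq_nonneg h']
  have hlt : b' < a := by
    by_contra! hge
    have hmul : a * a ≤ a * b' := mul_le_mul_of_nonneg_left hge ha.le
    have hda : 3 * a ^ 2 ≤ 4 * d := by linarith
    clear_value d b' h'
    clear ih hdet hdisc hpos hab hdb hsq hps hb' hh' hd hk1 hk2
    have hd3 : 3 * a ≤ 2 * d := by nlinarith [show 2 ≤ a by omega]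
    nlinarith [show 3 ≤ d by omega]
  obtain ⟨u, v, w, huvw⟩ := ih b'.toNat (by omega) b' a (b * q ^ 2 + 2 * f * q * s + c * s ^ 2)
    (h * q + g * s) (b * p * q + f * (p * s + q * r) + c * r * s - k * (h * q + g * s)) h'
    hb'pos (by linarith)
    (by rw [hb', hh']
        linear_combination (p * s - q * r) ^ 2 * hdet + (p * s - q * r + 1) * hps)
    (s * y - q * z) (x + k * (s * y - q * z)) (p * z - r * y) rfl
  refine ⟨u, v, w, huvw ▸ ?_⟩
  have hy : y = p * (s * y - q * z) + q * (p * z - r * y) := by linear_combination (-y) * hps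
  have hz : z = r * (s * y - q * z) + s * (p * z - r * y) := by linear_combination (-z) * hps
  generalize s * y - q * z = Y at hy hz ⊢
  generalize p * z - r * y = Z at hy hz ⊢
  rw [hb', hh', hy, hz]
  ring

lemma eq_sum_three_sq_of_dvd (n b t : ℤ) (hn : 0 < b * n - 1) (hb : 0 < b)
    (ht : b * n - 1 ∣ t ^ 2 + b) : ∃ u v w : ℤ, n = u ^ 2 + v ^ 2 + w ^ 2 := by
  obtain ⟨a, ha⟩ := ht
  have hapos : 0 < a := by
    by_contra! hneg
    nlinarith [sq_nonneg t]
  obtain ⟨u, v, w, h⟩ := ternary_det_one_eq_sum_three_sq a (b * n - 1) n 0 1 t hapos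
    (by linarith) (by linear_combination (-n) * ha) 0 0 1
  exact ⟨u, v, w, by linear_combination h⟩

lemma exists_dvd_sq_add_of_jacobiSym_eq_one {p : ℕ} (hp : p.Prime) {b : ℤ}
    (h : jacobiSym (-b) p = 1) : ∃ t : ℤ, (p : ℤ) ∣ t ^ 2 + b := by
  have := Fact.mk hp
  obtain ⟨t, ht⟩ := ZMod.isSquare_of_jacobiSym_eq_one h
  obtain ⟨t, rfl⟩ := ZMod.intCast_surjective t
  refine ⟨t, (ZMod.intCast_zmod_eq_zero_iff_dvd _ p).1 ?_⟩
  push_cast at ht ⊢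
  linear_combination -ht

lemma eq_sum_three_sq_of_mod_four_eq_two (n : ℕ) (hn : n % 4 = 2) :
    ∃ u v w : ℤ, (n : ℤ) = u ^ 2 + v ^ 2 + w ^ 2 := by
  have hcop : (n - 1).Coprime (4 * n) := by
    refine Nat.Coprime.mul_right ?_ ?_
    · exact Nat.Coprime.pow_right 2 (Nat.coprime_two_right.2 (Nat.odd_iff.2 (by omega)))
    · exact (Nat.coprime_self_sub_left (by omega)).2 (Nat.coprime_one_left n)
  obtain ⟨p, hpn, hp, hmod⟩ := Nat.forall_exists_prime_gt_and_modEq n (by omega) hcop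
  obtain ⟨j, hj⟩ := (Nat.modEq_iff_dvd' (by omega)).1 hmod.symm
  have hpj : p + 1 = (4 * j + 1) * n := by
    have : p = 4 * n * j + (n - 1) := by omega
    have : p + 1 = 4 * n * j + n := by omega
    linarith
  have hp4 : p % 4 = 1 := by
    have : p = 4 * (n * j) + (n - 1) := by rw [← mul_assoc]; omega
    omega
  have hbodd : Odd (4 * j + 1) := Nat.odd_iff.2 (by omega)
  have hpodd : Odd p := Nat.odd_iff.2 (by omega)
  have hJ : jacobiSym (-((4 * j + 1 : ℕ) : ℤ)) p = 1 := by
    rw [jacobiSym.neg _ hpodd, ZMod.χ₄_nat_one_mod_four hp4, one_mul,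
      jacobiSym.quadratic_reciprocity_one_mod_four (by omega) hpodd,
      jacobiSym.mod_left' (a₂ := -1), jacobiSym.at_neg_one hbodd,
      ZMod.χ₄_nat_one_mod_four (by omega)]
    refine Int.ModEq.symm ((Int.modEq_iff_dvd).2 ⟨n, ?_⟩)
    rw [sub_neg_eq_add]
    exact_mod_cast hpj
  obtain ⟨t, ht⟩ := exists_dvd_sq_add_of_jacobiSym_eq_one hp hJ
  have hpb : ((4 * j + 1 : ℕ) : ℤ) * n - 1 = p := by
    rw [sub_eq_iff_eq_add]
    exact_mod_cast hpj.symm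
  refine eq_sum_three_sq_of_dvd n (4 * j + 1 : ℕ) t ?_ (by positivity) (by rwa [hpb])
  rw [hpb]
  exact_mod_cast hp.pos

lemma eq_sum_three_sq_of_odd (n : ℕ) (hn : n % 8 = 1 ∨ n % 8 = 3 ∨ n % 8 = 5) :
    ∃ u v w : ℤ, (n : ℤ) = u ^ 2 + v ^ 2 + w ^ 2 := by
  obtain ⟨c, hc, hcn⟩ : ∃ c : ℕ, (c = 1 ∨ c = 3) ∧
      ((c = 1 ∧ n % 8 = 3) ∨ (c = 3 ∧ n % 8 = 1) ∨ (c = 3 ∧ n % 8 = 5)) := by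
    rcases hn with h | h | h
    · exact ⟨3, by omega⟩
    · exact ⟨1, by omega⟩
    · exact ⟨3, by omega⟩
  obtain ⟨e, he⟩ : ∃ e : ℕ, 2 * e + 1 = c * n := by
    rcases hc with rfl | rfl
    · exact ⟨(n - 1) / 2, by omega⟩
    · exact ⟨(3 * n - 1) / 2, by omega⟩
  have he2 : e % 2 = 1 := by
    rcases hcn with ⟨rfl, h⟩ | ⟨rfl, h⟩ | ⟨rfl, h⟩ <;> omega
  have hcop : e.Coprime (4 * n) := by
    refine Nat.Coprime.mul_right ?_ ?_
    · exact Nat.Coprime.pow_right 2 (Nat.coprime_two_right.2 (Nat.odd_iff.2 he2))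
    · refine Nat.isCoprime_iff_coprime.1 ⟨-2, c, ?_⟩
      have : (2 * e + 1 : ℤ) = c * n := by exact_mod_cast he
      linarith
  obtain ⟨p, hpe, hp, hmod⟩ := Nat.forall_exists_prime_gt_and_modEq e (by omega) hcop
  obtain ⟨j, hj⟩ := (Nat.modEq_iff_dvd' hpe.le).1 hmod.symm
  have hpj' : p = 4 * (n * j) + e := by rw [← mul_assoc]; omega
  obtain ⟨b, hb⟩ : ∃ b : ℕ, b = 8 * j + c := ⟨_, rfl⟩
  have hpj : 2 * p + 1 = b * n := by
    rw [hb, hpj']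
    linarith
  have hb8 : b % 8 = 1 ∨ b % 8 = 3 := by omega
  have hbodd : Odd b := Nat.odd_iff.2 (by omega)
  have hpodd : Odd p := Nat.odd_iff.2 (by omega)
  have hrec : jacobiSym (-(b : ℤ)) p = jacobiSym p b := by
    rw [jacobiSym.neg _ hpodd]
    by_cases hp4 : p % 4 = 1
    · rw [ZMod.χ₄_nat_one_mod_four hp4, one_mul,
        jacobiSym.quadratic_reciprocity_one_mod_four' hbodd hp4]
    · have hp4' : p % 4 = 3 := by omega
      have hb4 : b % 4 = 3 := by
        rcases hcn with ⟨rfl, h⟩ | ⟨rfl, h⟩ | ⟨rfl, h⟩ <;> omega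
      rw [ZMod.χ₄_nat_three_mod_four hp4',
        jacobiSym.quadratic_reciprocity_three_mod_four hb4 hp4']
      ring
  have hJ : jacobiSym (-(b : ℤ)) p = 1 := by
    have hfour : jacobiSym p b = jacobiSym (4 * p) b := by
      rw [jacobiSym.mul_left, jacobiSym.at_four hbodd, one_mul]
    rw [hrec, hfour, jacobiSym.mod_left' (a₂ := -2), jacobiSym.at_neg_two hbodd,
      ZMod.χ₈'_nat_eq_if_mod_eight]
    · rw [if_neg (by omega), if_pos hb8]
    · refine Int.ModEq.symm ((Int.modEq_iff_dvd).2 ⟨2 * n, ?_⟩)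
      have : (2 * p + 1 : ℤ) = b * n := by exact_mod_cast hpj
      linarith
  obtain ⟨t, ht, htodd⟩ : ∃ t : ℤ, (p : ℤ) ∣ t ^ 2 + b ∧ Odd t := by
    obtain ⟨t, ht⟩ := exists_dvd_sq_add_of_jacobiSym_eq_one hp hJ
    rcases Int.even_or_odd t with h | h
    · refine ⟨t + p, ?_, h.add_odd (by exact_mod_cast hpodd)⟩
      have : (t + p) ^ 2 + b = t ^ 2 + b + p * (2 * t + p) := by ring
      rw [this]
      exact dvd_add ht (dvd_mul_right _ _)
    · exact ⟨t, ht, h⟩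
  have h2 : (2 : ℤ) ∣ t ^ 2 + b :=
    (htodd.pow.add_odd (by exact_mod_cast hbodd)).two_dvd
  have hpb : (b : ℤ) * n - 1 = 2 * p := by
    rw [sub_eq_iff_eq_add]
    exact_mod_cast hpj.symm
  refine eq_sum_three_sq_of_dvd n b t ?_ (by exact_mod_cast hbodd.pos) ?_
  · rw [hpb]
    exact_mod_cast Nat.mul_pos two_pos hp.pos
  · rw [hpb]
    refine IsCoprime.mul_dvd ?_ h2 ht
    exact Nat.isCoprime_iff_coprime.2 (Nat.coprime_two_left.2 hpodd)

lemma exists_two_mul_sq_add_two_mul_sq_add_sq (n : ℕ)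
    (hn : n % 4 = 2 ∨ n % 8 = 1 ∨ n % 8 = 3 ∨ n % 8 = 5) :
    ∃ x y v : ℤ, (n : ℤ) = 2 * x ^ 2 + 2 * y ^ 2 + v ^ 2 := by
  have key : ∀ a b c : ℤ, Even (a - b) →
      ∃ x y v : ℤ, a ^ 2 + b ^ 2 + c ^ 2 = 2 * x ^ 2 + 2 * y ^ 2 + v ^ 2 := by
    rintro a b c ⟨k, hk⟩
    obtain rfl : a = b + 2 * k := by linarith
    exact ⟨b + k, k, c, by ring⟩
  obtain ⟨a, b, c, h⟩ : ∃ u v w : ℤ, (n : ℤ) = u ^ 2 + v ^ 2 + w ^ 2 := by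
    rcases hn with h | h
    · exact eq_sum_three_sq_of_mod_four_eq_two n h
    · exact eq_sum_three_sq_of_odd n h
  rw [h]
  have hpar : Even (a - b) ∨ Even (b - c) ∨ Even (c - a) := by
    simp only [Int.even_iff]
    omega
  rcases hpar with h | h | h
  · exact key a b c h
  · obtain ⟨x, y, v, hv⟩ := key b c a h
    exact ⟨x, y, v, by linarith⟩
  · obtain ⟨x, y, v, hv⟩ := key c a b h
    exact ⟨x, y, v, by linarith⟩

theorem stmt_8 (n : ℕ) (hn : 0 < n) :
    ∃ x y z w : ℤ, Int.gcd x (Int.gcd y (Int.gcd z w)) = 1 ∧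
      x ^ 2 + y ^ 2 + 2 * z ^ 2 + 8 * w ^ 2 + 2 * z * w = (n : ℤ) := by
  by_cases h4 : n % 4 = 3
  · by_cases h30 : n < 30
    · obtain rfl | rfl | rfl | rfl | rfl | rfl | rfl :
          n = 3 ∨ n = 7 ∨ n = 11 ∨ n = 15 ∨ n = 19 ∨ n = 23 ∨ n = 27 := by omega
      · exact ⟨1, 0, 1, 0, by decide⟩
      · exact ⟨2, 1, 1, 0, by decide⟩
      · exact ⟨3, 0, 1, 0, by decide⟩
      · exact ⟨2, 3, 1, 0, by decide⟩
      · exact ⟨1, 0, 3, 0, by decide⟩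
      · exact ⟨2, 1, 3, 0, by decide⟩
      · exact ⟨5, 0, 1, 0, by decide⟩
    · obtain ⟨x, y, v, h⟩ := exists_two_mul_sq_add_two_mul_sq_add_sq (2 * n - 60) (by omega)
      push_cast [show 60 ≤ 2 * n by omega] at h
      obtain ⟨t, rfl⟩ : Even v := by
        rw [← Int.even_pow' two_ne_zero, Int.even_iff]
        omega
      have hval : x ^ 2 + y ^ 2 + 2 * (t - 1) ^ 2 + 8 * 2 ^ 2 + 2 * (t - 1) * 2 = (n : ℤ) := by
        linarith
      refine ⟨x, y, t - 1, 2, ?_, hval⟩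
      set d := Int.gcd x (Int.gcd y (Int.gcd (t - 1) 2)) with hd
      have hdx : (d : ℤ) ∣ x := Int.gcd_dvd_left ..
      have hd1 : (d : ℤ) ∣ (Int.gcd y (Int.gcd (t - 1) 2) : ℤ) := Int.gcd_dvd_right ..
      have hdy : (d : ℤ) ∣ y := hd1.trans (Int.gcd_dvd_left ..)
      have hd2 : (d : ℤ) ∣ 2 := hd1.trans ((Int.gcd_dvd_right ..).trans (Int.gcd_dvd_right ..))
      rcases (Nat.dvd_prime Nat.prime_two).1 (by exact_mod_cast hd2 : d ∣ 2) with h1 | h2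
      · exact h1
      · rw [h2] at hdx hdy
        obtain ⟨x', rfl⟩ := hdx
        obtain ⟨y', rfl⟩ := hdy
        push_cast at hval
        ring_nf at hval
        omega
  · by_cases h8 : n < 8
    · obtain rfl | rfl | rfl | rfl | rfl | rfl :
          n = 1 ∨ n = 2 ∨ n = 4 ∨ n = 5 ∨ n = 6 ∨ n = 7 := by omega
      · exact ⟨1, 0, 0, 0, by decide⟩
      · exact ⟨1, 1, 0, 0, by decide⟩
      · exact ⟨1, 1, 1, 0, by decide⟩
      · exact ⟨2, 1, 0, 0, by decide⟩
      · exact ⟨2, 0, 1, 0, by decide⟩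
      · exact ⟨2, 1, 1, 0, by decide⟩
    · obtain ⟨x, y, v, h⟩ := exists_two_mul_sq_add_two_mul_sq_add_sq (2 * n - 15) (by omega)
      push_cast [show 15 ≤ 2 * n by omega] at h
      obtain ⟨z, rfl⟩ : Odd v := by
        rw [← Int.odd_pow' two_ne_zero, Int.odd_iff]
        omega
      exact ⟨x, y, z, 1, by simp, by linarith⟩
end
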